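/- arXiv:2011.08370 — 8 statements merged into one kernel-verified Lean document; each statement's English description precedes it below -/
import Mathlib

section
/- Let S be a functional on P (the disjoint union of all probability simplices P_n) satisfying: (I) for every n, S is continuous on P_n; (II) for every n and every p ∈ P_n, S(p) ≤ S(p^(n)) where p^(n) ∈ P_n is the uniform vector with all entries 1/n; (III) for every p = (p_1,...,p_n) ∈ P_n, S((p_1,...,p_n,0)) = S(p); (IV) for every m, n and every P = (p^i_j)_{1≤i≤m,1≤j≤n} ∈ P_{mn} whose column sums p_j := Σ_{i=1}^m p^i_j are all positive, S(P) = S((p_1,...,p_n)) + Σ_{j=1}^n p_j · S((p^1_j/p_j, ..., p^m_j/p_j)). Then there exists a constant c ≥ 0 such that S(p) = c · S₁(p) for all p ∈ P, where S₁ is the Boltzmann–Gibbs entropy. -/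
open Real Set

/-- `p` is an element of the probability simplex `P_n`. -/
def IsProbVec {n : ℕ} (p : Fin n → ℝ) : Prop :=
  (∀ j, 0 ≤ p j) ∧ ∑ j, p j = 1

/-- View a matrix `P : Fin m → Fin n → ℝ` as an element of the simplex on `m * n` entries. -/
def flatten {m n : ℕ} (P : Fin m → Fin n → ℝ) : Fin (m * n) → ℝ :=
  fun k => P (finProdFinEquiv.symm k).1 (finProdFinEquiv.symm k).2

open Filter Topology

/-- Axioms (I), (III) and (IV) for a functional on the disjoint union of all simplices. -/
structure IsExtensive (E : (n : ℕ) → (Fin n → ℝ) → ℝ) : Prop where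
  cont : ∀ n : ℕ, ContinuousOn (E n) {p : Fin n → ℝ | IsProbVec p}
  exp : ∀ n : ℕ, ∀ p : Fin n → ℝ, IsProbVec p → E (n + 1) (Fin.snoc p 0) = E n p
  ext : ∀ m n : ℕ, ∀ P : Fin m → Fin n → ℝ,
      (∀ i j, 0 ≤ P i j) → (∑ i, ∑ j, P i j = 1) → (∀ j, 0 < ∑ i, P i j) →
      E (m * n) (flatten P) =
        E n (fun j => ∑ i, P i j) +
          ∑ j, (∑ i, P i j) * E m (fun i => P i j / ∑ i', P i' j)

/-- A sequence `L` on the positive integers that is monotone and turns products into sums is a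
multiple of the logarithm. -/
lemma eq_mul_log_of_monotone_of_mul {L : ℕ → ℝ}
    (hmul : ∀ m n, 0 < m → 0 < n → L (m * n) = L m + L n)
    (hmono : ∀ n, 0 < n → L n ≤ L (n + 1)) (n : ℕ) (hn : 0 < n) :
    L n = L 2 / Real.log 2 * Real.log n := by
  have hL1 : L 1 = 0 := by have := hmul 1 1 one_pos one_pos; simp at this; exact this
  have hpow : ∀ a, 0 < a → ∀ k : ℕ, L (a ^ k) = k * L a := by
    intro a ha k
    induction k with
    | zero => simp [hL1]
    | succ k ih => rw [pow_succ, hmul _ _ (by positivity) ha, ih]; push_cast; ring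
  have hle : ∀ a b, 0 < a → a ≤ b → L a ≤ L b := by
    intro a b ha hab
    induction b, hab using Nat.le_induction with
    | base => exact le_rfl
    | succ b hab ih => exact ih.trans (hmono b (by omega))
  have hlog2 : 0 < Real.log 2 := Real.log_pos (by norm_num)
  have hL2 : 0 ≤ L 2 := hL1 ▸ hmono 1 one_pos
  have key : ∀ k : ℕ, k * |L n * Real.log 2 - L 2 * Real.log n| ≤ L 2 * Real.log 2 := by
    intro k
    have hnk : n ^ k ≠ 0 := by positivity
    have h1 := Nat.pow_log_le_self 2 hnk
    have h2 := Nat.lt_pow_succ_log_self (b := 2) (by norm_num) (n ^ k)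
    set m := Nat.log 2 (n ^ k)
    have a1 := hle _ _ (by positivity) h1
    have a2 := hle _ _ (by positivity) h2.le
    rw [hpow 2 (by norm_num), hpow n hn] at a1
    rw [hpow 2 (by norm_num), hpow n hn] at a2
    have b1 : Real.log ((2 : ℝ) ^ m) ≤ Real.log ((n : ℝ) ^ k) :=
      Real.log_le_log (by positivity) (by exact_mod_cast h1)
    have b2 : Real.log ((n : ℝ) ^ k) ≤ Real.log ((2 : ℝ) ^ (m + 1)) :=
      Real.log_le_log (by positivity) (by exact_mod_cast h2.le)
    rw [Real.log_pow, Real.log_pow] at b1 b2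
    push_cast at a2 b2
    have habs (x : ℝ) : k * |x| = |k * x| := by rw [abs_mul, Nat.abs_cast]
    rw [habs, abs_le]
    have c1 := mul_le_mul_of_nonneg_right a1 hlog2.le
    have c2 := mul_le_mul_of_nonneg_right a2 hlog2.le
    have c3 := mul_le_mul_of_nonneg_left b1 hL2
    have c4 := mul_le_mul_of_nonneg_left b2 hL2
    constructor <;> nlinarith
  have hzero : |L n * Real.log 2 - L 2 * Real.log n| = 0 := by
    by_contra hne
    have hpos := lt_of_le_of_ne (abs_nonneg _) (Ne.symm hne)
    obtain ⟨k, hk⟩ := exists_nat_gt (L 2 * Real.log 2 / |L n * Real.log 2 - L 2 * Real.log n|)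
    rw [div_lt_iff₀ hpos] at hk
    exact absurd (key k) (not_le.mpr hk)
  rw [abs_eq_zero, sub_eq_zero] at hzero
  field_simp
  linarith

namespace IsExtensive

variable {E : (n : ℕ) → (Fin n → ℝ) → ℝ}

lemma apply_one (hE : IsExtensive E) : E 1 (fun _ => 1) = 0 := by
  have h := hE.ext 1 1 (fun _ _ => 1) (by simp) (by simp) (by simp)
  have hf : flatten (m := 1) (n := 1) (fun _ _ => (1 : ℝ)) = fun _ => 1 := rfl
  rw [hf] at h
  simp at h
  exact h

lemma pad (hE : IsExtensive E) {f : ℕ → ℝ} {n m : ℕ} (hnm : n ≤ m) (h0 : ∀ i, 0 ≤ f i)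
    (h1 : ∑ i ∈ Finset.range n, f i = 1) (hz : ∀ i, n ≤ i → f i = 0) :
    E m (fun i => f i) = E n (fun i => f i) := by
  induction m, hnm using Nat.le_induction with
  | base => rfl
  | succ m hm ih =>
    have hsum : ∑ i ∈ Finset.range m, f i = 1 := by
      rw [← h1]
      refine (Finset.sum_subset (Finset.range_mono hm) fun i _ hi => hz i ?_).symm
      simpa using hi
    rw [← ih, ← hE.exp m (fun i => f i) ⟨fun _ => h0 _, by
      rw [← hsum, Finset.sum_range]⟩]
    congr 1
    ext i
    refine Fin.lastCases ?_ (fun j => ?_) i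
    · simp [hz m hm]
    · simp

/-- Extensivity for a matrix whose entries are listed, row by row, by a sequence. -/
lemma ext_seq (hE : IsExtensive E) (m n : ℕ) {f : ℕ → ℝ} (h0 : ∀ i, 0 ≤ f i)
    (h1 : ∑ i ∈ Finset.range (m * n), f i = 1)
    (hpos : ∀ j < n, 0 < ∑ i ∈ Finset.range m, f (j + n * i)) :
    E (m * n) (fun i => f i) = E n (fun j => ∑ i ∈ Finset.range m, f (j + n * i)) +
      ∑ j ∈ Finset.range n, (∑ i ∈ Finset.range m, f (j + n * i)) *
        E m (fun i => f (j + n * i) / ∑ i' ∈ Finset.range m, f (j + n * i')) := by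
  have h := hE.ext m n (fun i j => f (j + n * i)) (fun _ _ => h0 _) (by
      rw [← h1, Finset.sum_range, ← finProdFinEquiv.sum_comp, Fintype.sum_prod_type]
      rfl) (fun j => by
      have := hpos j j.2
      rwa [Finset.sum_range] at this)
  have hf : flatten (fun (i : Fin m) (j : Fin n) => f (j + n * i)) =
      fun k : Fin (m * n) => f k := by
    ext k
    obtain ⟨x, rfl⟩ := finProdFinEquiv.surjective k
    simp [flatten]
  rw [hf] at h
  simp only [Finset.sum_range] at h ⊢
  exact h

/-- The functional on two-point distributions, extended continuously to the whole line. -/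
def binary (E : (n : ℕ) → (Fin n → ℝ) → ℝ) (x : ℝ) : ℝ :=
  E 2 ![max 0 (min 1 x), 1 - max 0 (min 1 x)]

lemma binary_of_mem {x : ℝ} (h0 : 0 ≤ x) (h1 : x ≤ 1) : binary E x = E 2 ![x, 1 - x] := by
  simp [binary, h0, h1]

lemma apply_two {f : ℕ → ℝ} (h0 : 0 ≤ f 0) (h1 : 0 ≤ f 1) (h : f 0 + f 1 = 1) :
    E 2 (fun i => f i) = binary E (f 0) := by
  rw [binary_of_mem h0 (by linarith)]
  congr 1
  ext i
  fin_cases i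
  · simp
  · simp; linarith

lemma continuous_binary (hE : IsExtensive E) : Continuous (binary E) := by
  refine (hE.cont 2).comp_continuous (f := fun x : ℝ => ![max 0 (min 1 x), 1 - max 0 (min 1 x)])
    ?_ fun x => ⟨?_, ?_⟩
  · refine continuous_pi fun i => ?_
    fin_cases i
    · simp; fun_prop
    · simp; fun_prop
  · intro j
    fin_cases j <;> simp
  · simp

lemma binary_one (hE : IsExtensive E) : binary E 1 = 0 := by
  have h := hE.pad (f := fun i => if i = 0 then 1 else 0) (n := 1) (m := 2) (by norm_num)
    (fun i => by positivity) (by simp) (fun i hi => by simp; omega)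
  rw [apply_two (E := E) (f := fun i => if i = 0 then 1 else 0) (by simp) (by simp) (by simp)] at h
  simp at h
  rw [h, ← hE.apply_one]

/-- Merging the first and the last entry of a distribution. -/
lemma merge (hE : IsExtensive E) {f : ℕ → ℝ} {n : ℕ} (hn : 1 ≤ n) (hpos : ∀ i ≤ n, 0 < f i)
    (h1 : ∑ i ∈ Finset.range (n + 1), f i = 1) :
    E (n + 1) (fun i => f i) = E n (fun i => if (i : ℕ) = 0 then f 0 + f n else f i) +
      (f 0 + f n) * binary E (f 0 / (f 0 + f n)) := by
  set g : ℕ → ℝ := fun i => if i ≤ n then f i else 0 with hg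
  have g0 : ∀ i, 0 ≤ g i := fun i => by
    simp only [hg]; split_ifs with h
    exacts [(hpos i h).le, le_rfl]
  have g1 : ∑ i ∈ Finset.range (n + 1), g i = 1 := by
    rw [← h1]
    exact Finset.sum_congr rfl fun i hi => if_pos (by simpa [Nat.lt_succ_iff] using hi)
  have gz : ∀ i, n + 1 ≤ i → g i = 0 := fun i hi => if_neg (by omega)
  have hfg : (fun i : Fin (n + 1) => f i) = fun i : Fin (n + 1) => g i := by
    ext i
    exact (if_pos (Nat.lt_succ_iff.mp i.2)).symm
  have g2 : ∑ i ∈ Finset.range (2 * n), g i = 1 := by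
    rw [← g1]
    refine (Finset.sum_subset (Finset.range_mono (by omega)) fun i _ hi => gz i ?_).symm
    simpa using hi
  have hcol : ∀ j < n, ∑ i ∈ Finset.range 2, g (j + n * i) =
      if j = 0 then f 0 + f n else f j := by
    intro j hj
    rcases Nat.eq_zero_or_pos j with rfl | hj0
    · simp [Finset.sum_range_succ, hg]
    · simp [Finset.sum_range_succ, hg, hj.le, hj0.ne']
  have hf0 := hpos 0 (Nat.zero_le n)
  have hfn := hpos n le_rfl
  rw [hfg, ← hE.pad (m := 2 * n) (by omega) g0 g1 gz, hE.ext_seq 2 n g0 g2]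
  · congr 1
    · congr 1
      ext j
      exact hcol j j.2
    · rw [Finset.sum_eq_single_of_mem 0 (Finset.mem_range.mpr hn)]
      · rw [hcol 0 hn]
        simp only [if_true]
        rw [apply_two (E := E) (f := fun i => g (0 + n * i) / (f 0 + f n))]
        · simp [hg]
        · simp only [hg]; simp; positivity
        · simp only [hg]; simp; positivity
        · simp [hg]; field_simp
      · intro j hj hj0
        have hj' : j < n := by simpa using hj
        have hfj := hpos j hj'.le
        rw [hcol j hj', if_neg hj0, apply_two (E := E) (f := fun i => g (j + n * i) / f j)]
        · simp [hg, hj'.le, hfj.ne', hE.binary_one]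
        · simp [hg, hj'.le, hfj.ne']
        · simp [hg, hj0]
        · simp [hg, hj'.le, hj0, hfj.ne']
  · intro j hj
    rw [hcol j hj]
    split_ifs
    exacts [by positivity, hpos j hj.le]

/-- The fundamental equation of information. -/
lemma binary_add (hE : IsExtensive E) {a b d : ℝ} (ha : 0 < a) (hb : 0 < b) (hd : 0 < d)
    (h : a + b + d = 1) :
    binary E a + (1 - a) * binary E (b / (1 - a)) =
      binary E (a + d) + (a + d) * binary E (a / (a + d)) := by
  have hc := hE.continuous_binary
  have key : ∀ c : ℝ, 0 < c → c < d →
      binary E (a + c) + (a + c) * binary E (a / (a + c)) +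
        (1 - a - c) * binary E (b / (1 - a - c)) =
      binary E (a + d) + (a + d) * binary E ((a + d - c) / (a + d)) +
        (a + d - c) * binary E (a / (a + d - c)) := by
    intro c hc0 hcd
    have hac : 0 < 1 - a - c := by linarith
    have hdc : 0 < d - c := by linarith
    have hadc : 0 < a + d - c := by linarith
    let f : ℕ → ℝ := fun i => if i = 0 then a else if i = 1 then b else if i = 2 then c
      else d - c
    have f0 : f 0 = a := rfl
    have f1 : f 1 = b := rfl
    have f2 : f 2 = c := rfl
    have f3 : f 3 = d - c := rfl
    have fpos : ∀ i, 0 < f i := fun i => by simp only [f]; split_ifs <;> assumption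
    have fsum : ∑ i ∈ Finset.range (3 + 1), f i = 1 := by
      simp [Finset.sum_range_succ, f0, f1, f2, f3]; linarith
    have e1 := hE.ext_seq 2 2 (f := f) (fun i => (fpos i).le) fsum
      (fun j _ => Finset.sum_pos (fun _ _ => fpos _) (by simp))
    have e2 := hE.merge (n := 3) (by norm_num) (fun i _ => fpos i) fsum
    let g : ℕ → ℝ := fun i => if i = 0 then a + d - c else f i
    have g0 : g 0 = a + d - c := rfl
    have g1 : g 1 = b := rfl
    have g2 : g 2 = c := rfl
    have gpos : ∀ i, 0 < g i := fun i => by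
      simp only [g]; split_ifs
      exacts [hadc, fpos i]
    have e3 := hE.merge (n := 2) (f := g) (by norm_num) (fun i _ => gpos i) (by
      simp [Finset.sum_range_succ, g0, g1, g2]; linarith)
    have hfg : (fun i : Fin 3 => if (i : ℕ) = 0 then f 0 + f 3 else f i) = fun i : Fin 3 => g i := by
      ext i; simp only [g, f0, f3]; split_ifs
      exacts [by ring, rfl]
    rw [hfg, e3, apply_two (E := E) (f := fun i => if i = 0 then g 0 + g 2 else g i)] at e2
    rotate_left
    · simp [g0, g2]; linarith
    · simp [g1, hb.le]
    · simp [g0, g1, g2]; linarith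
    rw [apply_two (E := E) (f := fun j => ∑ i ∈ Finset.range 2, f (j + 2 * i))] at e1
    rotate_left
    · exact Finset.sum_nonneg fun _ _ => (fpos _).le
    · exact Finset.sum_nonneg fun _ _ => (fpos _).le
    · simp [Finset.sum_range_succ, f0, f1, f2, f3]; linarith
    have hcol : ∀ j, E 2 (fun i => f (j + 2 * i) / ∑ i' ∈ Finset.range 2, f (j + 2 * i')) =
        binary E (f j / (f j + f (j + 2))) := by
      intro j
      have := fpos j
      have := fpos (j + 2)
      rw [apply_two (E := E) (f := fun i => f (j + 2 * i) / ∑ i' ∈ Finset.range 2, f (j + 2 * i'))]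
      · simp [Finset.sum_range_succ]
      · simp [Finset.sum_range_succ]; positivity
      · simp [Finset.sum_range_succ]; positivity
      · simp [Finset.sum_range_succ]; field_simp
    simp only [hcol] at e1
    simp [Finset.sum_range_succ, f0, f1, f2, f3, g0, g2] at e1 e2
    have r1 : b + (d - c) = 1 - a - c := by linarith
    have r2 : a + (d - c) = a + d - c := by ring
    rw [r1] at e1
    rw [r2] at e2
    have e4 := e1.symm.trans e2
    linarith
  have hd1 : 1 - a ≠ 0 := by linarith
  have had : a + d ≠ 0 := by linarith
  have t1 : Tendsto (fun c : ℝ => binary E (a + c) + (a + c) * binary E (a / (a + c)) +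
      (1 - a - c) * binary E (b / (1 - a - c))) (𝓝[>] 0)
      (𝓝 (binary E (a + 0) + (a + 0) * binary E (a / (a + 0)) +
        (1 - a - 0) * binary E (b / (1 - a - 0)))) := by
    refine ContinuousAt.continuousWithinAt (f := fun c : ℝ => binary E (a + c) +
      (a + c) * binary E (a / (a + c)) + (1 - a - c) * binary E (b / (1 - a - c))) ?_
    have : a + 0 ≠ 0 := by simpa using ha.ne'
    have : 1 - a - 0 ≠ 0 := by simpa using hd1
    fun_prop (disch := assumption)
  have t2 : Tendsto (fun c : ℝ => binary E (a + d) +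
      (a + d) * binary E ((a + d - c) / (a + d)) +
      (a + d - c) * binary E (a / (a + d - c))) (𝓝[>] 0)
      (𝓝 (binary E (a + d) + (a + d) * binary E ((a + d - 0) / (a + d)) +
        (a + d - 0) * binary E (a / (a + d - 0)))) := by
    refine ContinuousAt.continuousWithinAt (f := fun c : ℝ => binary E (a + d) +
      (a + d) * binary E ((a + d - c) / (a + d)) +
      (a + d - c) * binary E (a / (a + d - c))) ?_
    have : a + d - 0 ≠ 0 := by simpa using had
    fun_prop (disch := assumption)
  have t3 := tendsto_nhds_unique (t1.congr' (by
    filter_upwards [Ioo_mem_nhdsGT hd] with c hcd using key c hcd.1 hcd.2)) t2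
  simp [ha.ne', had, hE.binary_one] at t3
  exact t3

lemma binary_one_sub_inv (hE : IsExtensive E) (hunif : ∀ n, 0 < n → E n (fun _ => 1 / n) = 0)
    (n : ℕ) (hn : 2 ≤ n) : binary E (1 - 1 / n) = 0 := by
  induction n using Nat.strong_induction_on with
  | _ n ih =>
    have hn0 : (0 : ℝ) < n := by positivity
    let f : ℕ → ℕ → ℝ := fun k i => if i = 0 then (n - k + 1) / n else 1 / n
    have hf : ∀ k, 2 ≤ k → k ≤ n → E k (fun i => f k i) = binary E (1 - 1 / n) := by
      intro k hk
      induction k, hk using Nat.le_induction with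
      | base =>
        intro _
        have hn2 : (2 : ℝ) ≤ n := by exact_mod_cast hn
        rw [apply_two (E := E) (f := f 2)]
        · congr 1; simp [f]; field_simp; ring
        · simp [f]; exact div_nonneg (by linarith) hn0.le
        · simp [f]
        · simp [f]; field_simp; ring
      | succ k hk ihk =>
        intro hkn
        have hkn' : (k : ℝ) + 1 ≤ n := by exact_mod_cast hkn
        have hnk : (0 : ℝ) < n - k := by linarith
        rw [← ihk (by omega), hE.merge (by omega)]
        · have e1 : f (k + 1) 0 + f (k + 1) k = (n - k + 1) / n := by
            have : k ≠ 0 := by omega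
            simp [f, this]; field_simp; ring
          have e2 : f (k + 1) 0 / ((n - k + 1) / n) = 1 - 1 / ((n - k + 1 : ℕ) : ℝ) := by
            rw [Nat.cast_add, Nat.cast_sub (by omega)]
            simp [f]
            have : (n : ℝ) - k + 1 ≠ 0 := by linarith
            field_simp; ring
          rw [e1, e2, ih (n - k + 1) (by omega) (by omega), mul_zero, add_zero]
          congr 1
          ext i
          simp only [f]
          split_ifs <;> rfl
        · intro i _
          simp only [f]
          split_ifs
          · push_cast; exact div_pos (by linarith) hn0
          · positivity
        · rw [Finset.sum_range_succ']
          simp [f]; field_simp; ring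
    rw [← hf n hn le_rfl, ← hunif n (by omega)]
    congr 1
    ext i
    simp only [f]
    split_ifs <;> simp

lemma binary_div (hE : IsExtensive E) (hunif : ∀ n, 0 < n → E n (fun _ => 1 / n) = 0)
    (n k : ℕ) (hk : 0 < k) (hkn : k < n) : binary E (k / n) = 0 := by
  induction n using Nat.strong_induction_on generalizing k with
  | _ n ih =>
    have hn0 : (0 : ℝ) < n := by exact_mod_cast (by omega : 0 < n)
    have hk0 : (0 : ℝ) < k := by exact_mod_cast hk
    have hinv := hE.binary_one_sub_inv hunif n (by omega)
    rcases (by omega : n = k + 1 ∨ k + 2 ≤ n) with rfl | hk2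
    · convert hinv using 2
      push_cast; field_simp; ring
    · have hk2' : (k : ℝ) + 2 ≤ n := by exact_mod_cast hk2
      have h := hE.binary_add (a := k / n) (b := 1 / n) (d := (n - k - 1) / n) (by positivity)
        (by positivity) (div_pos (by linarith) hn0) (by field_simp; ring)
      have e1 : (k : ℝ) / n + (n - k - 1) / n = 1 - 1 / n := by field_simp; ring
      have e2 : (k : ℝ) / n / (1 - 1 / n) = k / (n - 1 : ℕ) := by
        rw [Nat.cast_sub (by omega)]
        have : (n : ℝ) - 1 ≠ 0 := by linarith
        push_cast; field_simp
      have e3 : 1 / (n : ℝ) / (1 - k / n) = (1 : ℕ) / (n - k : ℕ) := by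
        rw [Nat.cast_sub (by omega)]
        have : (n : ℝ) - k ≠ 0 := by linarith
        push_cast; field_simp
      rw [e1, e2, e3, hinv, ih (n - 1) (by omega) k hk (by omega),
        ih (n - k) (by omega) 1 one_pos (by omega)] at h
      simpa using h

lemma binary_eq_zero (hE : IsExtensive E) (hunif : ∀ n, 0 < n → E n (fun _ => 1 / n) = 0)
    {x : ℝ} (hx : x ∈ Ioo (0 : ℝ) 1) : binary E x = 0 := by
  have hcl : IsClosed {x | binary E x = 0} := isClosed_eq hE.continuous_binary continuous_const
  have hsub : Ioo (0 : ℝ) 1 ∩ range ((↑) : ℚ → ℝ) ⊆ {x | binary E x = 0} := by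
    rintro _ ⟨⟨h0, h1⟩, q, rfl⟩
    have hq0 : 0 < q := by exact_mod_cast h0
    have hq1 : q < 1 := by exact_mod_cast h1
    have hnum : 0 < q.num := Rat.num_pos.mpr hq0
    have hlt : q.num < q.den := Rat.num_lt_denom_iff.mpr hq1
    have h := hE.binary_div hunif q.den q.num.toNat (by omega) (by omega)
    have hc : ((q.num.toNat : ℕ) : ℝ) = (q.num : ℝ) := by
      exact_mod_cast Int.toNat_of_nonneg hnum.le
    rw [hc, ← Rat.cast_def] at h
    exact h
  exact hcl.closure_subset_iff.mpr hsub
    (Rat.denseRange_cast.open_subset_closure_inter isOpen_Ioo hx)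

lemma eq_zero_of_pos (hE : IsExtensive E) (hunif : ∀ n, 0 < n → E n (fun _ => 1 / n) = 0)
    (n : ℕ) (hn : 1 ≤ n) {f : ℕ → ℝ} (hpos : ∀ i < n, 0 < f i)
    (h1 : ∑ i ∈ Finset.range n, f i = 1) : E n (fun i => f i) = 0 := by
  induction n, hn using Nat.le_induction generalizing f with
  | base =>
    rw [← hE.apply_one]
    congr 1
    ext i
    simpa [Subsingleton.elim i 0] using h1
  | succ n hn ih =>
    have hf0 := hpos 0 (by omega)
    have hfn := hpos n (by omega)
    rw [hE.merge hn (fun i hi => hpos i (by omega)) h1,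
      hE.binary_eq_zero hunif ⟨by positivity, (div_lt_one (by positivity)).mpr (by linarith)⟩,
      ih (f := fun i => if i = 0 then f 0 + f n else f i)]
    · simp
    · intro i hi
      split_ifs
      exacts [by positivity, hpos i (by omega)]
    · obtain ⟨m, rfl⟩ := Nat.exists_eq_add_of_le' hn
      rw [Finset.sum_range_succ, Finset.sum_range_succ'] at h1
      rw [Finset.sum_range_succ']
      simp at h1 ⊢
      linarith

/-- An extensive functional vanishing at all uniform distributions vanishes. -/
lemma eq_zero (hE : IsExtensive E) (hunif : ∀ n, 0 < n → E n (fun _ => 1 / n) = 0)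
    (n : ℕ) {p : Fin n → ℝ} (hp : IsProbVec p) : E n p = 0 := by
  have hn : 1 ≤ n := by
    rcases n with _ | n
    · simpa using hp.2
    · omega
  have hn0 : (0 : ℝ) < n := by exact_mod_cast hn
  let q : ℝ → Fin n → ℝ := fun t i => (1 - t) * p i + t * (1 / n)
  have hq1 : ∀ t, ∑ i, q t i = 1 := by
    intro t
    simp only [q, Finset.sum_add_distrib, ← Finset.mul_sum, hp.2]
    simp [hn0.ne']
  have hqpos : ∀ t ∈ Ioo (0 : ℝ) 1, ∀ i, 0 < q t i := fun t ht i =>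
    add_pos_of_nonneg_of_pos (mul_nonneg (by linarith [ht.2]) (hp.1 i))
      (mul_pos ht.1 (by positivity))
  have hqE : ∀ t ∈ Ioo (0 : ℝ) 1, E n (q t) = 0 := by
    intro t ht
    have h := hE.eq_zero_of_pos hunif n hn
      (f := fun i => if h : i < n then q t ⟨i, h⟩ else 0)
      (fun i hi => by simpa [hi] using hqpos t ht ⟨i, hi⟩)
      (by rw [Finset.sum_range]; simpa using hq1 t)
    simpa using h
  have hq0 : q 0 = p := by ext i; simp [q]
  have hqc : Tendsto q (𝓝[>] 0) (𝓝 p) := by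
    have : Continuous q := by fun_prop
    simpa [hq0] using (this.tendsto 0).mono_left nhdsWithin_le_nhds
  have hmem : Ioo (0 : ℝ) 1 ∈ 𝓝[>] (0 : ℝ) := Ioo_mem_nhdsGT one_pos
  have hqw : Tendsto q (𝓝[>] 0) (𝓝[{p | IsProbVec p}] p) :=
    tendsto_nhdsWithin_iff.mpr ⟨hqc, by
      filter_upwards [hmem] with t ht using ⟨fun i => (hqpos t ht i).le, hq1 t⟩⟩
  have hlim := (hE.cont n p hp).tendsto.comp hqw
  refine tendsto_nhds_unique hlim (tendsto_const_nhds.congr' ?_)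
  filter_upwards [hmem] with t ht using (hqE t ht).symm

lemma sub_const_mul {F : (n : ℕ) → (Fin n → ℝ) → ℝ} (hE : IsExtensive E) (hF : IsExtensive F)
    (c : ℝ) : IsExtensive (fun n p => E n p - c * F n p) where
  cont n := (hE.cont n).sub (continuousOn_const.mul (hF.cont n))
  exp n p hp := by simp only [hE.exp n p hp, hF.exp n p hp]
  ext m n P h0 h1 h2 := by
    simp only [hE.ext m n P h0 h1 h2, hF.ext m n P h0 h1 h2, mul_sub, Finset.sum_sub_distrib,
      mul_add, Finset.mul_sum, mul_left_comm c]
    ring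

end IsExtensive

lemma isExtensive_entropy :
    IsExtensive (fun n (p : Fin n → ℝ) => -∑ j, p j * Real.log (p j)) where
  cont n := by
    have := Real.continuous_mul_log
    exact (continuous_finsetSum _ fun j _ => this.comp (continuous_apply j)).neg.continuousOn
  exp n p _ := by simp [Fin.sum_univ_castSucc]
  ext m n P h0 _ hpos := by
    have hflat : ∑ k, flatten P k * Real.log (flatten P k) =
        ∑ j, ∑ i, P i j * Real.log (P i j) := by
      rw [← finProdFinEquiv.sum_comp, Fintype.sum_prod_type_right]
      simp [flatten]
    simp only [hflat, mul_neg, Finset.sum_neg_distrib, ← neg_add, ← Finset.sum_add_distrib]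
    congr 1
    refine Finset.sum_congr rfl fun j _ => ?_
    have hs := (hpos j).ne'
    generalize hsdef : ∑ i, P i j = s at hs
    have hi : ∀ i, s * (P i j / s * Real.log (P i j / s)) =
        P i j * Real.log (P i j) - P i j * Real.log s := by
      intro i
      rcases eq_or_ne (P i j) 0 with h | h
      · simp [h]
      · rw [Real.log_div h hs]; field_simp
    rw [Finset.mul_sum, Finset.sum_congr rfl fun i _ => hi i, Finset.sum_sub_distrib,
      ← Finset.sum_mul, hsdef]
    ring

/-- Shannon–Khinchin axioms characterize the Boltzmann–Gibbs entropy up to a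
nonnegative multiplicative constant. -/
theorem stmt_0
    (S : (n : ℕ) → (Fin n → ℝ) → ℝ)
    -- (I) continuity
    (hcont : ∀ n : ℕ, ContinuousOn (S n) {p : Fin n → ℝ | IsProbVec p})
    -- (II) maximality
    (hmax : ∀ n : ℕ, ∀ p : Fin n → ℝ, IsProbVec p → S n p ≤ S n (fun _ => 1 / (n : ℝ)))
    -- (III) expandability
    (hexp : ∀ n : ℕ, ∀ p : Fin n → ℝ, IsProbVec p → S (n + 1) (Fin.snoc p 0) = S n p)
    -- (IV) extensivity
    (hext : ∀ m n : ℕ, ∀ P : Fin m → Fin n → ℝ,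
      (∀ i j, 0 ≤ P i j) → (∑ i, ∑ j, P i j = 1) → (∀ j, 0 < ∑ i, P i j) →
      S (m * n) (flatten P) =
        S n (fun j => ∑ i, P i j) +
          ∑ j, (∑ i, P i j) * S m (fun i => P i j / ∑ i', P i' j)) :
    ∃ c : ℝ, 0 ≤ c ∧ ∀ n : ℕ, ∀ p : Fin n → ℝ, IsProbVec p →
      S n p = c * (-∑ j, p j * Real.log (p j)) := by
  have hS : IsExtensive S := ⟨hcont, hexp, hext⟩
  have hunif : ∀ n : ℕ, 0 < n → IsProbVec (fun _ : Fin n => 1 / (n : ℝ)) := fun n hn =>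
    ⟨fun _ => by positivity, by have : (n : ℝ) ≠ 0 := by positivity
                                simp [this]⟩
  let L : ℕ → ℝ := fun n => S n (fun _ => 1 / (n : ℝ))
  have hmono : ∀ n, 0 < n → L n ≤ L (n + 1) := by
    intro n hn
    have h := hunif n hn
    have h' : IsProbVec (Fin.snoc (fun _ : Fin n => 1 / (n : ℝ)) 0 : Fin (n + 1) → ℝ) := by
      refine ⟨fun j => ?_, ?_⟩
      · refine Fin.lastCases ?_ (fun i => ?_) j
        · simp
        · simp
      · rw [Fin.sum_univ_castSucc]
        simpa using h.2
    exact (hexp n _ h).symm.trans_le (hmax (n + 1) _ h')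
  have hmul : ∀ m n, 0 < m → 0 < n → L (m * n) = L m + L n := by
    intro m n hm hn
    have hm0 : (m : ℝ) ≠ 0 := by positivity
    have hn0 : (n : ℝ) ≠ 0 := by positivity
    have h := hS.ext_seq m n (f := fun _ => 1 / ((m * n : ℕ) : ℝ)) (fun _ => by positivity)
      (by simp; field_simp) (fun _ _ => Finset.sum_pos (fun _ _ => by positivity) (by simp; omega))
    simp only [Finset.sum_const, Finset.card_range, nsmul_eq_mul] at h
    have e3 : (m : ℝ) * (1 / ((m * n : ℕ) : ℝ)) = 1 / n := by push_cast; field_simp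
    have e4 : 1 / ((m * n : ℕ) : ℝ) / (1 / n) = 1 / m := by push_cast; field_simp
    simp only [e3, e4] at h
    rw [← mul_assoc, mul_one_div, div_self hn0, one_mul, add_comm] at h
    exact h
  have hL := eq_mul_log_of_monotone_of_mul hmul hmono
  have hL1 : L 1 = 0 := by simpa using hL 1 one_pos
  refine ⟨L 2 / Real.log 2, div_nonneg (hL1 ▸ hmono 1 one_pos) (Real.log_nonneg (by norm_num)),
    fun n p hp => sub_eq_zero.mp ?_⟩
  refine (hS.sub_const_mul isExtensive_entropy (L 2 / Real.log 2)).eq_zero (fun n hn => ?_) n hp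
  have hn0 : (n : ℝ) ≠ 0 := by positivity
  have := hL n hn
  simp only [L] at this ⊢
  rw [this]
  simp [hn0]
end

section
/- Let s ∈ C([0,1]) ∩ C²((0,1]) with s'' < 0 on (0,1], and define S : P → ℝ by S(p) = Σ_{j=1}^n s(p_j) for p ∈ P_n. Suppose there exists a function f : (0,1] → ℝ such that for all m, n and all P = (p^i_j) ∈ P_{mn} whose column sums p_j := Σ_{i=1}^m p^i_j are all positive, S(P) = S((p_1,...,p_n)) + Σ_{j=1}^n f(p_j) · S((p^1_j/p_j, ..., p^m_j/p_j)). Then there exists q > 0 such that f(r) = r^q for all r ∈ (0,1], and there exist constants a ∈ ℝ and k > 0 such that S(p) = k · S_q(p) + a for all p ∈ P, where S_q is the Tsallis entropy (and S₁ is the Boltzmann–Gibbs entropy when q = 1). -/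
open Real Set

/-- The entropy `S_q`: the Tsallis entropy for `q ≠ 1` and the Boltzmann–Gibbs
entropy for `q = 1` (here `x ^ q` is the real power, so `0 ^ q = 0` for `q > 0`). -/
noncomputable def Ent (q : ℝ) {n : ℕ} (p : Fin n → ℝ) : ℝ :=
  if q = 1 then -∑ j, p j * Real.log (p j) else (1 - ∑ j, p j ^ q) / (q - 1)

/-- A continuous function on `(0, 1]` turning products into sums is a multiple of `log`. -/
lemma eq_mul_log_of_map_mul {g : ℝ → ℝ} (hc : ContinuousOn g (Ioc 0 1))
    (hg : ∀ x ∈ Ioc (0:ℝ) 1, ∀ y ∈ Ioc (0:ℝ) 1, g (x * y) = g x + g y) :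
    ∃ κ : ℝ, ∀ x ∈ Ioc (0:ℝ) 1, g x = κ * Real.log x := by
  have hmem : ∀ t : ℝ, 0 ≤ t → Real.exp (-t) ∈ Ioc (0:ℝ) 1 := fun t ht =>
    ⟨Real.exp_pos _, Real.exp_le_one_iff.2 (by linarith)⟩
  have hadd : ∀ a b : ℝ, 0 ≤ a → 0 ≤ b →
      g (Real.exp (-(a + b))) = g (Real.exp (-a)) + g (Real.exp (-b)) := by
    intro a b ha hb
    rw [← hg _ (hmem a ha) _ (hmem b hb), ← Real.exp_add]
    congr 2
    ring
  have hzero : g 1 = 0 := by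
    have := hg 1 (by simp) 1 (by simp)
    rw [mul_one] at this
    linarith
  let L : ℝ →+ ℝ :=
    { toFun := fun t => g (Real.exp (-max t 0)) - g (Real.exp (-max (-t) 0))
      map_zero' := by simp
      map_add' := by
        intro a b
        have key : max (a + b) 0 + (max (-a) 0 + max (-b) 0)
            = max (-(a + b)) 0 + (max a 0 + max b 0) := by
          grind
        have h0 : ∀ t : ℝ, 0 ≤ max t 0 := fun t => le_max_right _ _
        have h1 := congrArg (fun t => g (Real.exp (-t))) key
        rw [hadd _ _ (h0 _) (add_nonneg (h0 _) (h0 _)), hadd _ _ (h0 _) (h0 _),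
          hadd _ _ (h0 _) (add_nonneg (h0 _) (h0 _)), hadd _ _ (h0 _) (h0 _)] at h1
        linarith }
  have hL : Continuous L := by
    apply Continuous.sub
    · exact hc.comp_continuous (by fun_prop) fun t => hmem _ (le_max_right _ _)
    · exact hc.comp_continuous (by fun_prop) fun t => hmem _ (le_max_right _ _)
  refine ⟨-L 1, fun x hx => ?_⟩
  have hlog : 0 ≤ -Real.log x := by
    have := Real.log_nonpos hx.1.le hx.2
    linarith
  have h1 := map_real_smul L hL (-Real.log x) 1
  have h2 : L (-Real.log x) = g x := by
    change g (Real.exp (-max (-Real.log x) 0)) - g (Real.exp (-max (- -Real.log x) 0)) = g x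
    rw [max_eq_left hlog, max_eq_right (by linarith)]
    simp [Real.exp_log hx.1, hzero]
  simp only [smul_eq_mul, mul_one] at h1
  rw [← h2, h1]
  ring

/-- A function on `[0, 1]`, differentiable on `(0, 1]` and satisfying Cauchy's equation up to
a constant, is affine. -/
lemma affine_of_map_add {h h' : ℝ → ℝ}
    (hd : ∀ x ∈ Ioc (0:ℝ) 1, HasDerivWithinAt h (h' x) (Ioc 0 1) x)
    (hadd : ∀ x y : ℝ, 0 < x → 0 < y → x + y ≤ 1 → h x + h y = h (x + y) + h 0) :
    ∀ x ∈ Ioc (0:ℝ) 1, h x = h 0 + (h 1 - h 0) * x := by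
  have hconst : ∀ x ∈ Ioc (0:ℝ) 1, h' x = h' 1 := by
    intro x hx
    rcases hx.2.eq_or_lt with rfl | hx1
    · rfl
    have hsub : Ioc 0 x ⊆ Ioc (0:ℝ) 1 := Ioc_subset_Ioc_right hx.2
    have hF : HasDerivWithinAt (fun z => h (z + (1 - x))) (h' 1) (Ioc 0 x) x := by
      have h1 : HasDerivWithinAt (fun z : ℝ => z + (1 - x)) 1 (Ioc 0 x) x :=
        ((hasDerivAt_id x).add_const _).hasDerivWithinAt
      have h2 : HasDerivWithinAt h (h' 1) (Ioc 0 1) (x + (1 - x)) := by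
        have := hd 1 (by simp)
        rwa [show x + (1 - x) = 1 by ring]
      have hmaps : MapsTo (fun z : ℝ => z + (1 - x)) (Ioc 0 x) (Ioc 0 1) := fun z hz =>
        ⟨by linarith [hz.1], by linarith [hz.2]⟩
      have := h2.comp x h1 hmaps
      simpa [Function.comp_def] using this
    have hxx : x ∈ Ioc (0:ℝ) x := ⟨hx.1, le_rfl⟩
    have hG : HasDerivWithinAt (fun z => h z + (h (1 - x) - h 0)) (h' x) (Ioc 0 x) x :=
      ((hd x hx).mono hsub).add_const _
    have hEq : HasDerivWithinAt (fun z => h z + (h (1 - x) - h 0)) (h' 1) (Ioc 0 x) x := by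
      refine hF.congr_of_mem (fun z hz => ?_) hxx
      have := hadd z (1 - x) hz.1 (by linarith) (by linarith [hz.2])
      linarith
    exact (uniqueDiffOn_Ioc 0 x x hxx).eq_deriv _ hG hEq
  have haff : ∀ x ∈ Ioc (0:ℝ) 1, h x = h 1 + h' 1 * (x - 1) := by
    intro x hx
    have hder : ∀ z ∈ Ioc (0:ℝ) 1,
        HasDerivWithinAt (fun z => h z - h' 1 * z) 0 (Ioc 0 1) z := by
      intro z hz
      have := (hd z hz).fun_sub ((hasDerivAt_id z).const_mul (h' 1)).hasDerivWithinAt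
      rw [hconst z hz] at this
      simpa using this
    have := (convex_Ioc (0:ℝ) 1).norm_image_sub_le_of_norm_hasDerivWithin_le (C := 0) hder
      (fun z _ => by simp) (by simp : (1:ℝ) ∈ Ioc (0:ℝ) 1) hx
    rw [zero_mul, norm_le_zero_iff] at this
    linarith
  intro x hx
  have h1 := hadd (1 / 2) (1 / 2) (by norm_num) (by norm_num) (by norm_num)
  have h2 := haff (1 / 2) (by norm_num)
  norm_num at h1 h2
  have h3 : h' 1 = h 1 - h 0 := by linarith
  rw [haff x hx, h3]
  ring

/-- Continuous solutions on `[0, 1]` of the functional equation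
`w (p x) = f p * w x + w p * x` that vanish at the endpoints and lie strictly above their chords
from the origin. -/
lemma entropy_function_eq {w f : ℝ → ℝ} (hw : ContinuousOn w (Icc 0 1))
    (hw0 : w 0 = 0) (hw1 : w 1 = 0)
    (hmid : ∀ p ∈ Ioc (0:ℝ) 1, w p / 2 < w (p / 2))
    (hwf : ∀ p ∈ Ioc (0:ℝ) 1, ∀ x ∈ Ioc (0:ℝ) 1, w (p * x) = f p * w x + w p * x) :
    ∃ q : ℝ, 0 < q ∧ (∀ r ∈ Ioc (0:ℝ) 1, f r = r ^ q) ∧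
      ∃ k : ℝ, 0 < k ∧ ∀ x ∈ Icc (0:ℝ) 1,
        w x = if q = 1 then -(k * (x * Real.log x)) else k * ((x - x ^ q) / (q - 1)) := by
  have hhalf : (1 / 2 : ℝ) ∈ Ioc (0:ℝ) 1 := by norm_num
  have hW : 0 < w (1 / 2) := by simpa [hw1] using hmid 1 (by simp)
  have hmem : ∀ x ∈ Ioc (0:ℝ) 1, ∀ y ∈ Ioc (0:ℝ) 1, x * y ∈ Ioc (0:ℝ) 1 := fun x hx y hy =>
    ⟨mul_pos hx.1 hy.1, mul_le_one₀ hx.2 hy.1.le hy.2⟩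
  have hf : ∀ p ∈ Ioc (0:ℝ) 1, f p = (w (p / 2) - w p / 2) / w (1 / 2) := by
    intro p hp
    have := hwf p hp _ hhalf
    rw [eq_div_iff hW.ne', show p / 2 = p * (1 / 2) by ring, this]
    ring
  have hfpos : ∀ p ∈ Ioc (0:ℝ) 1, 0 < f p := by
    intro p hp
    rw [hf p hp]
    exact div_pos (by linarith [hmid p hp]) hW
  have hfmul : ∀ x ∈ Ioc (0:ℝ) 1, ∀ y ∈ Ioc (0:ℝ) 1, f (x * y) = f x * f y := by
    intro x hx y hy
    have h1 := hwf _ (hmem x hx y hy) _ hhalf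
    have h2 := hwf x hx _ (hmem y hy _ hhalf)
    rw [hwf x hx y hy] at h1
    rw [hwf y hy _ hhalf, ← mul_assoc, h1] at h2
    have h3 : (f (x * y) - f x * f y) * w (1 / 2) = 0 := by linear_combination h2
    rcases mul_eq_zero.1 h3 with h | h
    · linarith
    · exact absurd h hW.ne'
  have hDc : ContinuousOn (fun p => w (p / 2) - w p / 2) (Icc 0 1) := by
    refine ContinuousOn.sub (hw.comp (by fun_prop) ?_) (hw.div_const 2)
    intro x hx
    exact ⟨by linarith [hx.1], by linarith [hx.1, hx.2]⟩
  have hfc : ContinuousOn f (Ioc 0 1) :=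
    ((hDc.mono Ioc_subset_Icc_self).div_const _).congr hf
  obtain ⟨q, hq⟩ := eq_mul_log_of_map_mul (g := fun x => Real.log (f x))
    (hfc.log fun x hx => (hfpos x hx).ne') (fun x hx y hy => by
      simp only [hfmul x hx y hy]
      exact Real.log_mul (hfpos x hx).ne' (hfpos y hy).ne')
  have hfq : ∀ r ∈ Ioc (0:ℝ) 1, f r = r ^ q := by
    intro r hr
    rw [Real.rpow_def_of_pos hr.1, mul_comm, ← hq r hr, Real.exp_log (hfpos r hr)]
  have hq0 : 0 < q := by
    by_contra! hq0
    have hlim : Filter.Tendsto (fun p => w (p / 2) - w p / 2) (nhdsWithin 0 (Ioi 0))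
        (nhds 0) := by
      have := (hDc 0 (by simp)).mono Ioc_subset_Icc_self
      rw [ContinuousWithinAt, nhdsWithin_Ioc_eq_nhdsGT zero_lt_one] at this
      simpa [hw0] using this
    have hge : ∀ᶠ p in nhdsWithin (0:ℝ) (Ioi 0), w (1 / 2) ≤ w (p / 2) - w p / 2 := by
      filter_upwards [Ioc_mem_nhdsGT (zero_lt_one : (0:ℝ) < 1)] with p hp
      have h1 := hf p hp
      have h2 : 1 ≤ f p := by
        rw [hfq p hp]
        exact Real.one_le_rpow_of_pos_of_le_one_of_nonpos hp.1 hp.2 hq0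
      rwa [h1, le_div_iff₀ hW, one_mul] at h2
    exact absurd (ge_of_tendsto hlim hge) (not_le.2 hW)
  refine ⟨q, hq0, hfq, ?_⟩
  by_cases hq1 : q = 1
  · subst hq1
    obtain ⟨κ, hκ⟩ := eq_mul_log_of_map_mul (g := fun x => w x / x)
      ((hw.mono Ioc_subset_Icc_self).div continuousOn_id fun x hx => hx.1.ne')
      (fun x hx y hy => by
        have hx0 := hx.1.ne'
        have hy0 := hy.1.ne'
        simp only [hwf x hx y hy, hfq x hx, Real.rpow_one]
        field_simp
        ring)
    have hwx : ∀ x ∈ Ioc (0:ℝ) 1, w x = κ * (x * Real.log x) := by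
      intro x hx
      have := (div_eq_iff hx.1.ne').1 (hκ x hx)
      rw [this]
      ring
    refine ⟨-κ, ?_, fun x hx => ?_⟩
    · have hlog : Real.log (1 / 2) < 0 := Real.log_neg (by norm_num) (by norm_num)
      have := hwx _ hhalf
      by_contra! hk
      nlinarith
    · rw [if_pos rfl]
      rcases hx.1.eq_or_lt with rfl | hx0
      · simp [hw0]
      · rw [hwx x ⟨hx0, hx.2⟩]
        ring
  · set c : ℝ := 1 / 2 - (1 / 2) ^ q with hc
    have hsign : 0 < (q - 1) / c := by
      rcases lt_or_gt_of_ne hq1 with h | h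
      · refine div_pos_of_neg_of_neg (by linarith) ?_
        have := Real.rpow_lt_rpow_of_exponent_gt (by norm_num : (0:ℝ) < 1 / 2) (by norm_num) h
        rw [Real.rpow_one] at this
        linarith
      · refine div_pos (by linarith) ?_
        have := Real.rpow_lt_rpow_of_exponent_gt (by norm_num : (0:ℝ) < 1 / 2) (by norm_num) h
        rw [Real.rpow_one] at this
        linarith
    have hc0 : c ≠ 0 := fun h => by simp [h] at hsign
    have hq1' : q - 1 ≠ 0 := sub_ne_zero.2 hq1
    refine ⟨w (1 / 2) * ((q - 1) / c), mul_pos hW hsign, fun x hx => ?_⟩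
    rw [if_neg hq1]
    rcases hx.1.eq_or_lt with rfl | hx0
    · simp [hw0, Real.zero_rpow hq0.ne']
    · have hx' : x ∈ Ioc (0:ℝ) 1 := ⟨hx0, hx.2⟩
      have h1 := hwf x hx' _ hhalf
      have h2 := hwf _ hhalf x hx'
      rw [mul_comm, h2, hfq x hx', hfq _ hhalf] at h1
      have h3 : w x * c = w (1 / 2) * (x - x ^ q) := by
        rw [hc]
        linear_combination -h1
      field_simp
      linear_combination h3

/-- A function with negative second derivative on `(0, 1]` lies strictly above its chords from
the origin at their midpoints. -/
lemma midpoint_lt_of_second_deriv_neg {s s' s'' : ℝ → ℝ}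
    (hs : ContinuousOn s (Icc 0 1))
    (hds : ∀ x ∈ Ioc (0:ℝ) 1, HasDerivWithinAt s (s' x) (Ioc 0 1) x)
    (hds' : ∀ x ∈ Ioc (0:ℝ) 1, HasDerivWithinAt s' (s'' x) (Ioc 0 1) x)
    (hneg : ∀ x ∈ Ioc (0:ℝ) 1, s'' x < 0) :
    ∀ p ∈ Ioc (0:ℝ) 1, (s 0 + s p) / 2 < s (p / 2) := by
  have hnhds : ∀ x ∈ Ioo (0:ℝ) 1, Ioc (0:ℝ) 1 ∈ nhds x := fun x hx => Ioc_mem_nhds hx.1 hx.2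
  have hconc : StrictConcaveOn ℝ (Icc 0 1) s := by
    refine strictConcaveOn_of_deriv2_neg (convex_Icc 0 1) hs fun x hx => ?_
    rw [interior_Icc] at hx
    have hev : deriv s =ᶠ[nhds x] s' := by
      filter_upwards [Ioo_mem_nhds hx.1 hx.2] with z hz
      exact ((hds z (Ioo_subset_Ioc_self hz)).hasDerivAt (hnhds z hz)).deriv
    have hx' := Ioo_subset_Ioc_self hx
    simp only [Function.iterate_succ, Function.iterate_zero, Function.comp_apply, id]
    rw [hev.deriv_eq, ((hds' x hx').hasDerivAt (hnhds x hx)).deriv]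
    exact hneg x hx'
  intro p hp
  have := hconc.2 (by simp : (0:ℝ) ∈ Icc (0:ℝ) 1) (Ioc_subset_Icc_self hp) hp.1.ne
    (by norm_num : (0:ℝ) < 1 / 2) (by norm_num : (0:ℝ) < 1 / 2) (by norm_num)
  simp only [smul_eq_mul, mul_zero, zero_add] at this
  rw [show 1 / 2 * p = p / 2 by ring] at this
  linarith

/-- If the coefficients of the conditional entropies in the extensivity identity are
given by a function `f` of the column sums, then `f` is a power function `r ^ q` with
`q > 0`, and `S` coincides with the Tsallis entropy `S_q` (Boltzmann–Gibbs if `q = 1`)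
up to an additive constant and a multiplicative positive constant. -/
theorem stmt_1
    (s s' s'' : ℝ → ℝ)
    (hs : ContinuousOn s (Icc 0 1))
    (hds : ∀ x ∈ Ioc (0:ℝ) 1, HasDerivWithinAt s (s' x) (Ioc 0 1) x)
    (hds' : ∀ x ∈ Ioc (0:ℝ) 1, HasDerivWithinAt s' (s'' x) (Ioc 0 1) x)
    (hs''cont : ContinuousOn s'' (Ioc 0 1))
    (hneg : ∀ x ∈ Ioc (0:ℝ) 1, s'' x < 0)
    (f : ℝ → ℝ)
    (hf : ∀ m n : ℕ, ∀ P : Fin m → Fin n → ℝ,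
      (∀ i j, 0 ≤ P i j) → (∑ i, ∑ j, P i j = 1) → (∀ j, 0 < ∑ i, P i j) →
      ∑ i, ∑ j, s (P i j) =
        (∑ j, s (∑ i, P i j)) +
          ∑ j, f (∑ i, P i j) * ∑ i, s (P i j / ∑ i', P i' j)) :
    ∃ q : ℝ, 0 < q ∧ (∀ r ∈ Ioc (0:ℝ) 1, f r = r ^ q) ∧
      ∃ k : ℝ, 0 < k ∧ ∃ a : ℝ, ∀ n : ℕ, ∀ p : Fin n → ℝ, IsProbVec p →
        ∑ j, s (p j) = k * Ent q p + a := by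
  have hmid := midpoint_lt_of_second_deriv_neg hs hds hds' hneg
  have hone : f 1 = 1 ∧ s 1 = 0 := by
    have h1 := hf 2 1 ![![1 / 2], ![1 / 2]]
      (by intro i j; fin_cases i <;> fin_cases j <;> norm_num)
      (by norm_num [Fin.sum_univ_succ])
      (by intro j; fin_cases j; norm_num [Fin.sum_univ_succ])
    have h2 := hf 2 1 ![![1], ![0]]
      (by intro i j; fin_cases i <;> fin_cases j <;> norm_num)
      (by norm_num [Fin.sum_univ_succ])
      (by intro j; fin_cases j; norm_num [Fin.sum_univ_succ])
    have h3 := hmid 1 (by simp)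
    norm_num [Fin.sum_univ_succ] at h1 h2 h3
    have h4 : (1 - f 1) * (s (1 / 2) + s (1 / 2) - (s 1 + s 0)) = 0 := by
      linear_combination h1 - h2
    have h5 : f 1 = 1 := by
      rcases mul_eq_zero.1 h4 with h | h
      · linarith
      · linarith
    refine ⟨h5, ?_⟩
    rw [h5] at h2
    linarith
  obtain ⟨hf1, hs1⟩ := hone
  have hcol : ∀ p ∈ Ioo (0:ℝ) 1, ∀ x y z : ℝ, 0 ≤ x → 0 ≤ y → 0 ≤ z → x + y + z = 1 →
      s (p * x) + s (p * y) + s (p * z) + s (1 - p) + 2 * s 0 =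
        s p + s (1 - p) + f p * (s x + s y + s z) + f (1 - p) * (2 * s 0) := by
    intro p hp x y z hx hy hz hxyz
    have hp0 := hp.1
    have hp1 : 0 < 1 - p := by linarith [hp.2]
    have hpx := mul_nonneg hp0.le hx
    have hpy := mul_nonneg hp0.le hy
    have hpz := mul_nonneg hp0.le hz
    have hsum : p * x + (p * y + p * z) = p := by linear_combination p * hxyz
    have h1 := hf 3 2 ![![p * x, 1 - p], ![p * y, 0], ![p * z, 0]]
      (by intro i j; fin_cases i <;> fin_cases j <;> simp <;> linarith)
      (by simp [Fin.sum_univ_succ]; linarith)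
      (by intro j; fin_cases j <;> simp [Fin.sum_univ_succ] <;> linarith)
    simp [Fin.sum_univ_succ, hsum, mul_div_cancel_left₀ _ hp0.ne', div_self hp1.ne', hs1] at h1
    linear_combination h1
  have haff : ∀ p ∈ Ioo (0:ℝ) 1, ∀ x ∈ Ioc (0:ℝ) 1,
      s (p * x) - f p * s x = s 0 - f p * s 0 + (s p - (s 0 - f p * s 0)) * x := by
    intro p hp
    have := affine_of_map_add (h := fun x => s (p * x) - f p * s x)
      (h' := fun x => s' (p * x) * p - f p * s' x) (fun x hx => ?_) (fun x y hx hy hxy => ?_)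
    · simpa [hs1] using this
    · have hm : ∀ z ∈ Ioc (0:ℝ) 1, p * z ∈ Ioc (0:ℝ) 1 := fun z hz =>
        ⟨mul_pos hp.1 hz.1, mul_le_one₀ hp.2.le hz.1.le hz.2⟩
      have h1 : HasDerivWithinAt (fun z : ℝ => p * z) p (Ioc 0 1) x := by
        simpa using ((hasDerivAt_id x).const_mul p).hasDerivWithinAt (s := Ioc 0 1)
      exact ((hds _ (hm x hx)).comp x h1 hm).sub ((hds x hx).const_mul (f p))
    · have h1 := hcol p hp x y (1 - x - y) hx.le hy.le (by linarith) (by ring)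
      have h2 := hcol p hp (x + y) 0 (1 - x - y) (by linarith) le_rfl (by linarith) (by ring)
      simp only [mul_zero] at h2 ⊢
      linear_combination h1 - h2
  obtain ⟨q, hq0, hfq, k, hk, hw⟩ := entropy_function_eq
    (w := fun x => s x - s 0 * (1 - x)) (f := f)
    (hs.sub (by fun_prop)) (by simp) (by simp [hs1])
    (fun p hp => by
      have := hmid p hp
      linarith)
    (fun p hp x hx => by
      rcases hp.2.eq_or_lt with rfl | hp1
      · simp [hf1, hs1]
      · linear_combination haff p ⟨hp.1, hp1⟩ x hx)
  have hs0 : s 0 = 0 := by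
    have h1 := hf 2 2 ![![1 / 2, 1 / 2], ![0, 0]]
      (by intro i j; fin_cases i <;> fin_cases j <;> norm_num)
      (by norm_num [Fin.sum_univ_succ])
      (by intro j; fin_cases j <;> norm_num [Fin.sum_univ_succ])
    have h2 : f (1 / 2) < 1 := by
      rw [hfq _ (by norm_num)]
      exact Real.rpow_lt_one (by norm_num) (by norm_num) hq0
    norm_num [Fin.sum_univ_succ, hs1] at h1 h2
    have h3 : s 0 * (1 - f (1 / 2)) = 0 := by linarith
    exact (mul_eq_zero.1 h3).resolve_right (by linarith)
  refine ⟨q, hq0, hfq, k, hk, 0, fun n p hp => ?_⟩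
  have hp1 : ∀ j, p j ∈ Icc (0:ℝ) 1 := fun j =>
    ⟨hp.1 j, hp.2 ▸ Finset.single_le_sum (fun i _ => hp.1 i) (Finset.mem_univ j)⟩
  have hsp : ∀ j, s (p j) = if q = 1 then -(k * (p j * Real.log (p j)))
      else k * ((p j - p j ^ q) / (q - 1)) := fun j => by
    simpa [hs0] using hw (p j) (hp1 j)
  simp only [hsp, Ent, add_zero]
  split_ifs with h
  · rw [Finset.sum_neg_distrib, ← Finset.mul_sum, mul_neg]
  · rw [← Finset.mul_sum, ← Finset.sum_div, Finset.sum_sub_distrib, hp.2]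
end

section
/- Let s ∈ C([0,1]) ∩ C²((0,1]) with s(0) = s(1) = 0 and s'' < 0 on (0,1], and define S : P → ℝ by S(p) = Σ_{j=1}^n s(p_j) for p ∈ P_n. Assume that for every r ∈ (0,1] the quantity sup_{t ∈ (0,1]} s''(rt)/s''(t) is finite, and define f̲(r) := r² · inf_{t∈(0,1]} s''(rt)/s''(t) and f̄(r) := r² · sup_{t∈(0,1]} s''(rt)/s''(t) for r ∈ (0,1]. Then for all m, n and all P = (p^i_j) ∈ P_{mn} with column sums p_j := Σ_{i=1}^m p^i_j all positive, the following two inequalities hold: Σ_{j=1}^n f̲(p_j) S((p^1_j/p_j,...,p^m_j/p_j)) + s'(1) Σ_{j=1}^n (f̄(p_j) − f̲(p_j)) ≤ S(P) − S((p_1,...,p_n)) ≤ Σ_{j=1}^n f̄(p_j) S((p^1_j/p_j,...,p^m_j/p_j)) − s'(1) Σ_{j=1}^n (f̄(p_j) − f̲(p_j)). -/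
open Real Set

/-- `f̲(r) = r² · inf_{t ∈ (0,1]} s''(rt)/s''(t)`. -/
noncomputable def flo (s'' : ℝ → ℝ) (r : ℝ) : ℝ :=
  r ^ 2 * ⨅ t : Set.Ioc (0:ℝ) 1, s'' (r * (t : ℝ)) / s'' (t : ℝ)

/-- `f̄(r) = r² · sup_{t ∈ (0,1]} s''(rt)/s''(t)`. -/
noncomputable def fup (s'' : ℝ → ℝ) (r : ℝ) : ℝ :=
  r ^ 2 * ⨆ t : Set.Ioc (0:ℝ) 1, s'' (r * (t : ℝ)) / s'' (t : ℝ)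

/-- A convex function on `[0, 1]` vanishing at `0` lies below its chord through the origin. -/
lemma ConvexOn.le_mul_of_map_zero {h : ℝ → ℝ} (hh : ConvexOn ℝ (Icc 0 1) h) (h0 : h 0 = 0)
    {x : ℝ} (hx : x ∈ Icc (0:ℝ) 1) : h x ≤ x * h 1 := by
  have := hh.2 (left_mem_Icc.2 zero_le_one) (right_mem_Icc.2 zero_le_one)
    (sub_nonneg.2 hx.2) hx.1 (by ring)
  simpa [h0] using this

/-- Superadditivity of a convex function on `[0, 1]` vanishing at `0`. -/
lemma ConvexOn.sum_le_map_one {ι : Type*} [Fintype ι] {h : ℝ → ℝ}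
    (hh : ConvexOn ℝ (Icc 0 1) h) (h0 : h 0 = 0) {x : ι → ℝ} (hx : ∀ i, 0 ≤ x i)
    (hsum : ∑ i, x i = 1) : ∑ i, h (x i) ≤ h 1 := by
  have hx1 (i : ι) : x i ≤ 1 :=
    hsum ▸ Finset.single_le_sum (fun i _ => hx i) (Finset.mem_univ i)
  calc ∑ i, h (x i) ≤ ∑ i, x i * h 1 :=
        Finset.sum_le_sum fun i _ => hh.le_mul_of_map_zero h0 ⟨hx i, hx1 i⟩
    _ = h 1 := by rw [← Finset.sum_mul, hsum, one_mul]

section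

variable {s'' s' s : ℝ → ℝ}

/-- Convexity of a linear combination of `s (r * ·)` and `s`, via its second derivative. -/
lemma convexOn_dilation_comb (hs : ContinuousOn s (Icc 0 1))
    (hds : ∀ x ∈ Ioc (0:ℝ) 1, HasDerivWithinAt s (s' x) (Ioc 0 1) x)
    (hds' : ∀ x ∈ Ioc (0:ℝ) 1, HasDerivWithinAt s' (s'' x) (Ioc 0 1) x)
    {r a b : ℝ} (hr : r ∈ Ioc (0:ℝ) 1)
    (h : ∀ t ∈ Ioc (0:ℝ) 1, 0 ≤ b * (r ^ 2 * s'' (r * t)) + a * s'' t) :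
    ConvexOn ℝ (Icc 0 1) fun t => b * s (r * t) + a * s t := by
  have at_of_within {f f' : ℝ → ℝ}
      (hf : ∀ x ∈ Ioc (0:ℝ) 1, HasDerivWithinAt f (f' x) (Ioc 0 1) x) :
      ∀ x ∈ Ioo (0:ℝ) 1, HasDerivAt f (f' x) x := fun x hx =>
    (hf x (Ioo_subset_Ioc_self hx)).hasDerivAt (Ioc_mem_nhds hx.1 hx.2)
  have hmul (x : ℝ) (hx : x ∈ Ioo (0:ℝ) 1) : r * x ∈ Ioo (0:ℝ) 1 :=
    ⟨mul_pos hr.1 hx.1, by nlinarith [hr.1, hr.2, hx.1, hx.2]⟩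
  have hlin (x : ℝ) : HasDerivAt (fun t => r * t) r x := by
    simpa using (hasDerivAt_id x).const_mul r
  refine convexOn_of_hasDerivWithinAt2_nonneg (convex_Icc 0 1)
    (f' := fun t => b * (s' (r * t) * r) + a * s' t)
    (f'' := fun t => b * (s'' (r * t) * r * r) + a * s'' t) ?_ ?_ ?_ ?_
  · refine (ContinuousOn.const_mul (hs.comp (by fun_prop) fun x hx => ?_) b).add
      (hs.const_mul a)
    exact ⟨mul_nonneg hr.1.le hx.1, mul_le_one₀ hr.2 hx.1 hx.2⟩
  all_goals rw [interior_Icc]; intro x hx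
  · exact ((((at_of_within hds _ (hmul x hx)).comp x (hlin x)).const_mul b).add
      ((at_of_within hds x hx).const_mul a)).hasDerivWithinAt
  · exact (((((at_of_within hds' _ (hmul x hx)).comp x (hlin x)).mul_const r).const_mul b).add
      ((at_of_within hds' x hx).const_mul a)).hasDerivWithinAt
  · convert h x (Ioo_subset_Ioc_self hx) using 1
    ring

lemma le_fup_mul (hneg : ∀ x ∈ Ioc (0:ℝ) 1, s'' x < 0) {r : ℝ}
    (hbdd : BddAbove (Set.range fun t : Set.Ioc (0:ℝ) 1 => s'' (r * (t : ℝ)) / s'' (t : ℝ)))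
    {t : ℝ} (ht : t ∈ Ioc (0:ℝ) 1) : fup s'' r * s'' t ≤ r ^ 2 * s'' (r * t) := by
  have h := (div_le_iff_of_neg (hneg t ht)).1 (le_ciSup hbdd ⟨t, ht⟩)
  rw [fup, mul_assoc]
  exact mul_le_mul_of_nonneg_left h (sq_nonneg r)

lemma bddBelow_dilation_ratio (hneg : ∀ x ∈ Ioc (0:ℝ) 1, s'' x < 0) {r : ℝ}
    (hr : r ∈ Ioc (0:ℝ) 1) :
    BddBelow (Set.range fun t : Set.Ioc (0:ℝ) 1 => s'' (r * (t : ℝ)) / s'' (t : ℝ)) := by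
  refine ⟨0, ?_⟩
  rintro _ ⟨t, rfl⟩
  exact div_nonneg_of_nonpos
    (hneg _ ⟨mul_pos hr.1 t.2.1, mul_le_one₀ hr.2 t.2.1.le t.2.2⟩).le (hneg _ t.2).le

lemma le_flo_mul (hneg : ∀ x ∈ Ioc (0:ℝ) 1, s'' x < 0) {r : ℝ} (hr : r ∈ Ioc (0:ℝ) 1)
    {t : ℝ} (ht : t ∈ Ioc (0:ℝ) 1) : r ^ 2 * s'' (r * t) ≤ flo s'' r * s'' t := by
  have h := (le_div_iff_of_neg (hneg t ht)).1
    (ciInf_le (bddBelow_dilation_ratio hneg hr) ⟨t, ht⟩)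
  rw [flo, mul_assoc]
  exact mul_le_mul_of_nonneg_left h (sq_nonneg r)

lemma flo_le_fup (hneg : ∀ x ∈ Ioc (0:ℝ) 1, s'' x < 0) {r : ℝ} (hr : r ∈ Ioc (0:ℝ) 1)
    (hbdd : BddAbove (Set.range fun t : Set.Ioc (0:ℝ) 1 => s'' (r * (t : ℝ)) / s'' (t : ℝ))) :
    flo s'' r ≤ fup s'' r := by
  have h1 : (1:ℝ) ∈ Ioc (0:ℝ) 1 := right_mem_Ioc.2 one_pos
  exact (mul_le_mul_right_of_neg (hneg 1 h1)).1
    ((le_fup_mul hneg hbdd h1).trans (le_flo_mul hneg hr h1))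

lemma deriv_one_nonpos (hs : ContinuousOn s (Icc 0 1)) (hs0 : s 0 = 0) (hs1 : s 1 = 0)
    (hds : ∀ x ∈ Ioc (0:ℝ) 1, HasDerivWithinAt s (s' x) (Ioc 0 1) x)
    (hds' : ∀ x ∈ Ioc (0:ℝ) 1, HasDerivWithinAt s' (s'' x) (Ioc 0 1) x)
    (hneg : ∀ x ∈ Ioc (0:ℝ) 1, s'' x < 0) : s' 1 ≤ 0 := by
  obtain ⟨c, hc, hc0⟩ := exists_hasDerivAt_eq_zero (f' := s') one_pos hs (hs0.trans hs1.symm)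
    fun x hx => (hds x (Ioo_subset_Ioc_self hx)).hasDerivAt (Ioc_mem_nhds hx.1 hx.2)
  have hanti : AntitoneOn s' (Ioc 0 1) := by
    refine antitoneOn_of_hasDerivWithinAt_nonpos (f' := s'') (convex_Ioc 0 1)
      (fun x hx => (hds' x hx).continuousWithinAt) ?_ ?_
    · exact fun x hx => (hds' x (interior_subset hx)).mono interior_subset
    · exact fun x hx => (hneg x (interior_subset hx)).le
  exact hc0 ▸ hanti (Ioo_subset_Ioc_self hc) (right_mem_Ioc.2 one_pos) hc.2.le

end

/-- Two-sided estimate on the difference `S(P) − S((p_1,…,p_n))` for a functional with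
concave `C²` density. -/
theorem stmt_2
    (s s' s'' : ℝ → ℝ)
    (hs : ContinuousOn s (Icc 0 1))
    (hs0 : s 0 = 0) (hs1 : s 1 = 0)
    (hds : ∀ x ∈ Ioc (0:ℝ) 1, HasDerivWithinAt s (s' x) (Ioc 0 1) x)
    (hds' : ∀ x ∈ Ioc (0:ℝ) 1, HasDerivWithinAt s' (s'' x) (Ioc 0 1) x)
    (hs''cont : ContinuousOn s'' (Ioc 0 1))
    (hneg : ∀ x ∈ Ioc (0:ℝ) 1, s'' x < 0)
    (hbdd : ∀ r ∈ Ioc (0:ℝ) 1,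
      BddAbove (Set.range fun t : Set.Ioc (0:ℝ) 1 => s'' (r * (t : ℝ)) / s'' (t : ℝ)))
    (m n : ℕ) (P : Fin m → Fin n → ℝ)
    (hP : ∀ i j, 0 ≤ P i j) (hsum : ∑ i, ∑ j, P i j = 1)
    (hcol : ∀ j, 0 < ∑ i, P i j) :
    (∑ j, flo s'' (∑ i, P i j) * (∑ i, s (P i j / ∑ i', P i' j)) +
        s' 1 * ∑ j, (fup s'' (∑ i, P i j) - flo s'' (∑ i, P i j)) ≤
      (∑ i, ∑ j, s (P i j)) - ∑ j, s (∑ i, P i j)) ∧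
    ((∑ i, ∑ j, s (P i j)) - ∑ j, s (∑ i, P i j) ≤
      ∑ j, fup s'' (∑ i, P i j) * (∑ i, s (P i j / ∑ i', P i' j)) -
        s' 1 * ∑ j, (fup s'' (∑ i, P i j) - flo s'' (∑ i, P i j))) := by
  set p : Fin n → ℝ := fun j => ∑ i, P i j with hp
  have hp1 (j : Fin n) : p j ∈ Ioc (0:ℝ) 1 := by
    refine ⟨hcol j, ?_⟩
    rw [Finset.sum_comm] at hsum
    exact hsum ▸ Finset.single_le_sum (f := p) (fun j _ => (hcol j).le) (Finset.mem_univ j)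
  have hx (j : Fin n) (i : Fin m) : 0 ≤ P i j / p j := div_nonneg (hP i j) (hcol j).le
  have hx1 (j : Fin n) : ∑ i, P i j / p j = 1 := by
    rw [← Finset.sum_div, div_self (hcol j).ne']
  have hmul (j : Fin n) (i : Fin m) : p j * (P i j / p j) = P i j :=
    mul_div_cancel₀ _ (hcol j).ne'
  have hup (j : Fin n) :
      ∑ i, s (P i j) - s (p j) ≤ fup s'' (p j) * ∑ i, s (P i j / p j) := by
    have h := (convexOn_dilation_comb (a := -fup s'' (p j)) (b := 1) hs hds hds' (hp1 j)
      fun t ht => by linarith [le_fup_mul hneg (hbdd _ (hp1 j)) ht]).sum_le_map_one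
      (by simp [hs0]) (hx j) (hx1 j)
    simp only [hmul, Finset.sum_add_distrib, ← Finset.mul_sum, mul_one, hs1] at h
    linarith
  have hlo (j : Fin n) :
      flo s'' (p j) * ∑ i, s (P i j / p j) ≤ ∑ i, s (P i j) - s (p j) := by
    have h := (convexOn_dilation_comb (a := flo s'' (p j)) (b := -1) hs hds hds' (hp1 j)
      fun t ht => by linarith [le_flo_mul hneg (hp1 j) ht]).sum_le_map_one
      (by simp [hs0]) (hx j) (hx1 j)
    simp only [hmul, Finset.sum_add_distrib, ← Finset.mul_sum, mul_one, hs1] at h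
    linarith
  have hcorr : s' 1 * ∑ j, (fup s'' (p j) - flo s'' (p j)) ≤ 0 :=
    mul_nonpos_of_nonpos_of_nonneg (deriv_one_nonpos hs hs0 hs1 hds hds' hneg)
      (Finset.sum_nonneg fun j _ =>
        sub_nonneg.2 (flo_le_fup hneg (hp1 j) (hbdd _ (hp1 j))))
  have hlo' := Finset.sum_le_sum fun j (_ : j ∈ Finset.univ) => hlo j
  have hup' := Finset.sum_le_sum fun j (_ : j ∈ Finset.univ) => hup j
  rw [Finset.sum_sub_distrib] at hlo' hup'
  rw [Finset.sum_comm (f := fun i j => s (P i j))]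
  constructor <;> linarith
end

section
/- Define s : [0,1] → ℝ by s(r) = −∫_0^r ∫_0^t u(|cos(1/u)| + u) du dt. Then s ∈ C([0,1]) ∩ C²((0,1]) with s''(r) = −r(|cos(1/r)| + r) < 0 for all r ∈ (0,1], and sup_{t∈(0,1]} s''(t/2)/s''(t) = ∞. In particular, setting t_k = ((k + 1/2)π)^{-1} for k ∈ ℕ, one has s''(t_k/2)/s''(t_k) = (1/2)((k + 1/2)π + 1/2), which tends to infinity as k → ∞. -/
open Real Set Filter

/-- `s(r) = −∫_0^r ∫_0^t u(|cos(1/u)| + u) du dt`. -/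
noncomputable def badDensity (r : ℝ) : ℝ :=
  -∫ t in (0:ℝ)..r, ∫ u in (0:ℝ)..t, u * (|Real.cos (1 / u)| + u)

theorem continuous_mul_abs_cos_inv_add :
    Continuous fun u : ℝ => u * (|Real.cos (1 / u)| + u) := by
  rw [continuous_iff_continuousAt]
  intro x
  rcases eq_or_ne x 0 with rfl | hx
  · have hsq : Tendsto (fun u : ℝ => |u| * (1 + |u|)) (nhds 0) (nhds 0) := by
      have h : Continuous fun u : ℝ => |u| * (1 + |u|) := by fun_prop
      simpa using h.tendsto 0
    rw [ContinuousAt, zero_mul]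
    refine squeeze_zero_norm (fun u => ?_) hsq
    rw [Real.norm_eq_abs, abs_mul]
    gcongr
    refine (abs_add_le _ _).trans ?_
    rw [abs_abs]
    gcongr
    exact Real.abs_cos_le_one _
  · fun_prop (disch := exact hx)

theorem hasDerivAt_badDensity (r : ℝ) :
    HasDerivAt badDensity (-∫ u in (0:ℝ)..r, u * (|Real.cos (1 / u)| + u)) r := by
  have hcont : Continuous fun t : ℝ => ∫ u in (0:ℝ)..t, u * (|Real.cos (1 / u)| + u) :=
    intervalIntegral.continuous_primitive
      (fun a b => continuous_mul_abs_cos_inv_add.intervalIntegrable a b) 0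
  exact (hcont.integral_hasStrictDerivAt 0 r).hasDerivAt.neg

theorem hasDerivAt_deriv_badDensity (r : ℝ) :
    HasDerivAt (deriv badDensity) (-(r * (|Real.cos (1 / r)| + r))) r := by
  rw [show deriv badDensity = fun r => -∫ u in (0:ℝ)..r, u * (|Real.cos (1 / u)| + u) from
    funext fun r => (hasDerivAt_badDensity r).deriv]
  exact (continuous_mul_abs_cos_inv_add.integral_hasStrictDerivAt 0 r).hasDerivAt.neg

theorem deriv_deriv_badDensity_half_div (k : ℕ) :
    deriv (deriv badDensity) ((((k : ℝ) + 1 / 2) * Real.pi)⁻¹ / 2) /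
        deriv (deriv badDensity) ((((k : ℝ) + 1 / 2) * Real.pi)⁻¹) =
      (1 / 2) * (((k : ℝ) + 1 / 2) * Real.pi + 1 / 2) := by
  have hcos : Real.cos (((k : ℝ) + 1 / 2) * Real.pi) = 0 :=
    Real.cos_eq_zero_iff.2 ⟨k, by push_cast; ring⟩
  have hcos_two : |Real.cos (2 * (((k : ℝ) + 1 / 2) * Real.pi))| = 1 := by
    rw [Real.cos_two_mul, hcos]
    norm_num
  have hpos : 0 < ((k : ℝ) + 1 / 2) * Real.pi := by positivity
  rw [(hasDerivAt_deriv_badDensity _).deriv, (hasDerivAt_deriv_badDensity _).deriv]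
  generalize ((k : ℝ) + 1 / 2) * Real.pi = T at *
  rw [show 1 / (T⁻¹ / 2) = 2 * T by field_simp, show 1 / T⁻¹ = T by field_simp, hcos, hcos_two,
    abs_zero]
  field_simp
  ring

theorem tendsto_deriv_deriv_badDensity_half_div :
    Tendsto (fun k : ℕ =>
      deriv (deriv badDensity) ((((k : ℝ) + 1 / 2) * Real.pi)⁻¹ / 2) /
        deriv (deriv badDensity) ((((k : ℝ) + 1 / 2) * Real.pi)⁻¹)) atTop atTop := by
  simp_rw [deriv_deriv_badDensity_half_div]
  refine Tendsto.const_mul_atTop (by norm_num) (tendsto_atTop_add_const_right _ _ ?_)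
  exact (tendsto_atTop_add_const_right _ _ tendsto_natCast_atTop_atTop).atTop_mul_const
    Real.pi_pos

/-- The function `s(r) = −∫_0^r ∫_0^t u(|cos(1/u)| + u) du dt` is continuous on `[0,1]`,
`C²` on `(0,1]` with `s''(r) = −r(|cos(1/r)| + r) < 0`, yet
`sup_{t ∈ (0,1]} s''(t/2)/s''(t) = ∞`; indeed along `t_k = ((k + 1/2)π)⁻¹` the ratio
equals `(1/2)((k + 1/2)π + 1/2) → ∞`. -/
theorem stmt_7 :
    ContinuousOn badDensity (Icc 0 1) ∧
    (∀ r ∈ Ioc (0:ℝ) 1,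
      DifferentiableAt ℝ badDensity r ∧
      DifferentiableAt ℝ (deriv badDensity) r ∧
      deriv (deriv badDensity) r = -(r * (|Real.cos (1 / r)| + r)) ∧
      deriv (deriv badDensity) r < 0) ∧
    ¬ BddAbove (Set.range fun t : Ioc (0:ℝ) 1 =>
      deriv (deriv badDensity) ((t : ℝ) / 2) / deriv (deriv badDensity) (t : ℝ)) ∧
    (∀ k : ℕ,
      deriv (deriv badDensity) ((((k : ℝ) + 1 / 2) * Real.pi)⁻¹ / 2) /
          deriv (deriv badDensity) ((((k : ℝ) + 1 / 2) * Real.pi)⁻¹) =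
        (1 / 2) * (((k : ℝ) + 1 / 2) * Real.pi + 1 / 2)) ∧
    Tendsto (fun k : ℕ =>
      deriv (deriv badDensity) ((((k : ℝ) + 1 / 2) * Real.pi)⁻¹ / 2) /
        deriv (deriv badDensity) ((((k : ℝ) + 1 / 2) * Real.pi)⁻¹)) atTop atTop := by
  refine ⟨fun r _ => (hasDerivAt_badDensity r).continuousAt.continuousWithinAt, fun r hr => ?_, ?_,
    deriv_deriv_badDensity_half_div, tendsto_deriv_deriv_badDensity_half_div⟩
  · have hr0 : 0 < r := hr.1
    refine ⟨(hasDerivAt_badDensity r).differentiableAt,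
      (hasDerivAt_deriv_badDensity r).differentiableAt, (hasDerivAt_deriv_badDensity r).deriv, ?_⟩
    rw [(hasDerivAt_deriv_badDensity r).deriv, neg_lt_zero]
    positivity
  · rintro ⟨B, hB⟩
    obtain ⟨k, hk, hk1⟩ := ((tendsto_deriv_deriv_badDensity_half_div.eventually_gt_atTop B).and
      (eventually_ge_atTop 1)).exists
    have hk1' : (1 : ℝ) ≤ k := by exact_mod_cast hk1
    have hT : 1 ≤ ((k : ℝ) + 1 / 2) * Real.pi := by nlinarith [Real.pi_gt_three]
    exact hk.not_ge (hB ⟨⟨_, inv_pos.2 (by positivity), inv_le_one_of_one_le₀ hT⟩, rfl⟩)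
end

section
/- Let s ∈ C([0,1]) ∩ C²((0,1]) with s'' < 0 on (0,1], define S(p) = Σ_j s(p_j) on P, and suppose f : (0,1] → ℝ satisfies S(P) = S((p_1,...,p_n)) + Σ_{j=1}^n f(p_j) S((p^1_j/p_j,...,p^m_j/p_j)) for all P ∈ P_{mn} with all column sums p_j positive. Then for every r ∈ (0,1), every ξ ∈ (0,1], and every x ∈ (0,ξ): r²(s''(rx) + s''(r(ξ−x))) = f(r)(s''(x) + s''(ξ−x)). In particular (taking x = ξ/2), f(r)/r² = s''(rx)/s''(x) for all x ∈ (0,1/2] and r ∈ (0,1). -/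
open Real Set

/-- Derivative of a combination of a dilation of `g` and its reflection about `ξ / 2`. -/
lemma hasDerivAt_dilation_add_reflection {g g' : ℝ → ℝ}
    (hg : ∀ y ∈ Ioo (0:ℝ) 1, HasDerivAt g (g' y) y) {r ξ x : ℝ} (hr : r ∈ Ioc (0:ℝ) 1)
    (hξ : ξ ≤ 1) (hx : x ∈ Ioo 0 ξ) (c : ℝ) :
    HasDerivAt (fun x => g (r * x) + c * g (r * (ξ - x)))
      (r * (g' (r * x) - c * g' (r * (ξ - x)))) x := by
  obtain ⟨hr0, hr1⟩ := hr
  obtain ⟨hx0, hx1⟩ := hx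
  have h₁ : HasDerivAt (fun x => r * x) (r * 1) x := (hasDerivAt_id x).const_mul r
  have h₂ : HasDerivAt (fun x => r * (ξ - x)) (r * (-1)) x :=
    ((hasDerivAt_id x).const_sub ξ).const_mul r
  have hgx := (hg (r * x) ⟨by positivity, by nlinarith⟩).comp x h₁
  have hgy := (hg (r * (ξ - x)) ⟨mul_pos hr0 (by linarith), by nlinarith⟩).comp x h₂
  exact (hgx.add (hgy.const_mul c)).congr_deriv (by ring)

lemma HasDerivAt.eq_zero_of_const_on_Ioo {g : ℝ → ℝ} {a b c x d : ℝ}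
    (hd : HasDerivAt g d x) (hx : x ∈ Ioo a b) (hg : ∀ y ∈ Ioo a b, g y = c) : d = 0 :=
  hd.unique <| (hasDerivAt_const x c).congr_of_eventuallyEq <|
    Filter.eventually_of_mem (Ioo_mem_nhds hx.1 hx.2) hg

/-- Key differential identity in the proof of the power-coefficient theorem: the
generalized extensivity identity forces
`r²(s''(rx) + s''(r(ξ−x))) = f(r)(s''(x) + s''(ξ−x))`, and in particular
`f(r)/r² = s''(rx)/s''(x)`. -/
theorem stmt_8
    (s s' s'' : ℝ → ℝ)
    (hs : ContinuousOn s (Icc 0 1))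
    (hds : ∀ x ∈ Ioc (0:ℝ) 1, HasDerivWithinAt s (s' x) (Ioc 0 1) x)
    (hds' : ∀ x ∈ Ioc (0:ℝ) 1, HasDerivWithinAt s' (s'' x) (Ioc 0 1) x)
    (hs''cont : ContinuousOn s'' (Ioc 0 1))
    (hneg : ∀ x ∈ Ioc (0:ℝ) 1, s'' x < 0)
    (f : ℝ → ℝ)
    (hf : ∀ m n : ℕ, ∀ P : Fin m → Fin n → ℝ,
      (∀ i j, 0 ≤ P i j) → (∑ i, ∑ j, P i j = 1) → (∀ j, 0 < ∑ i, P i j) →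
      ∑ i, ∑ j, s (P i j) =
        (∑ j, s (∑ i, P i j)) +
          ∑ j, f (∑ i, P i j) * ∑ i, s (P i j / ∑ i', P i' j)) :
    (∀ r ∈ Ioo (0:ℝ) 1, ∀ ξ ∈ Ioc (0:ℝ) 1, ∀ x ∈ Ioo (0:ℝ) ξ,
      r ^ 2 * (s'' (r * x) + s'' (r * (ξ - x))) = f r * (s'' x + s'' (ξ - x))) ∧
    (∀ x ∈ Ioc (0:ℝ) (1 / 2), ∀ r ∈ Ioo (0:ℝ) 1,
      f r / r ^ 2 = s'' (r * x) / s'' x) := by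
  have hs₁ : ∀ y ∈ Ioo (0:ℝ) 1, HasDerivAt s (s' y) y := fun y hy =>
    (hds y (Ioo_subset_Ioc_self hy)).hasDerivAt (Ioc_mem_nhds hy.1 hy.2)
  have hs₂ : ∀ y ∈ Ioo (0:ℝ) 1, HasDerivAt s' (s'' y) y := fun y hy =>
    (hds' y (Ioo_subset_Ioc_self hy)).hasDerivAt (Ioc_mem_nhds hy.1 hy.2)
  have key : ∀ r ∈ Ioo (0:ℝ) 1, ∀ ξ ∈ Ioc (0:ℝ) 1, ∀ x ∈ Ioo (0:ℝ) ξ,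
      r ^ 2 * (s'' (r * x) + s'' (r * (ξ - x))) = f r * (s'' x + s'' (ξ - x)) := by
    rintro r ⟨hr0, hr1⟩ ξ ⟨hξ0, hξ1⟩
    have hr : r ∈ Ioc (0:ℝ) 1 := ⟨hr0, hr1.le⟩
    have h1 : (1:ℝ) ∈ Ioc (0:ℝ) 1 := ⟨one_pos, le_rfl⟩
    have hconst : ∀ x ∈ Ioo (0:ℝ) ξ,
        (s (r * x) + 1 * s (r * (ξ - x))) - f r * (s (1 * x) + 1 * s (1 * (ξ - x))) =
          s r + f r * s (1 - ξ) + f (1 - r) * (s 1 + 2 * s 0)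
            - s (r * (1 - ξ)) - 2 * s 0 := by
      rintro x ⟨hx0, hxξ⟩
      have hrx : r * x + r * (ξ - x) + r * (1 - ξ) = r := by ring
      have h := hf 3 2 ![![r * x, 1 - r], ![r * (ξ - x), 0], ![r * (1 - ξ), 0]]
        (by
          have h₁ : 0 ≤ r * x := by positivity
          have h₂ : 0 ≤ r * (ξ - x) := mul_nonneg hr0.le (by linarith)
          have h₃ : 0 ≤ r * (1 - ξ) := mul_nonneg hr0.le (by linarith)
          intro i j
          fin_cases i <;> fin_cases j <;> simp <;> linarith)
        (by simp [Fin.sum_univ_succ]; ring)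
        (by
          intro j
          fin_cases j <;> simp [Fin.sum_univ_three, hrx] <;> linarith)
      simp only [Fin.sum_univ_three, Fin.sum_univ_two, Matrix.cons_val, add_zero, hrx,
        mul_div_cancel_left₀ _ hr0.ne', div_self (sub_pos.2 hr1).ne', zero_div] at h
      rw [one_mul, one_mul, one_mul, one_mul]
      linear_combination h
    have hfirst : ∀ x ∈ Ioo (0:ℝ) ξ,
        r * (s' (r * x) + -1 * s' (r * (ξ - x)))
          - f r * (s' (1 * x) + -1 * s' (1 * (ξ - x))) = 0 := fun x hx => by
      have h := ((hasDerivAt_dilation_add_reflection hs₁ hr hξ1 hx 1).sub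
        ((hasDerivAt_dilation_add_reflection hs₁ h1 hξ1 hx 1).const_mul (f r))
        ).eq_zero_of_const_on_Ioo hx hconst
      linear_combination h
    intro x hx
    have h := (((hasDerivAt_dilation_add_reflection hs₂ hr hξ1 hx (-1)).const_mul r).sub
      ((hasDerivAt_dilation_add_reflection hs₂ h1 hξ1 hx (-1)).const_mul (f r))
      ).eq_zero_of_const_on_Ioo hx hfirst
    simp only [one_mul] at h
    linear_combination h
  refine ⟨key, ?_⟩
  rintro x ⟨hx0, hx1⟩ r hr
  have h := key r hr (2 * x) ⟨by linarith, by linarith⟩ x ⟨hx0, by linarith⟩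
  rw [show 2 * x - x = x by ring] at h
  rw [div_eq_div_iff (pow_pos hr.1 2).ne' (hneg x ⟨hx0, by linarith⟩).ne]
  linear_combination -h / 2
end

section
/- Let s ∈ C([0,1]) ∩ C²((0,1]) satisfy s''(r) = s''(1)·r^{q−2} for all r ∈ (0,1], where s''(1) < 0 and q ∈ ℝ. Then: (a) if q = 1, s(r) = k₁ r log r + a₁ r + b₁ on (0,1] with k₁ = s''(1), a₁ = −s''(1) + s'(1), b₁ = s''(1) − s'(1) + s(1); (b) q = 0 is impossible (no such s extends continuously to 0); (c) if q ≠ 0 and q ≠ 1, then necessarily q > 0 and s(r) = k_q (r^q − r)/(q−1) + a_q r + b_q on (0,1] with k_q = s''(1)/q, a_q = −s''(1)/q + s'(1), b_q = s''(1)/q − s'(1) + s(1). -/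
open Real Set

open Filter Topology

/-- Two functions on `(0, 1]` with the same derivative and the same value at `1` agree. -/
lemma eqOn_Ioc_of_hasDerivWithinAt {f g d : ℝ → ℝ}
    (hf : ∀ x ∈ Ioc (0:ℝ) 1, HasDerivWithinAt f (d x) (Ioc 0 1) x)
    (hg : ∀ x ∈ Ioc (0:ℝ) 1, HasDerivWithinAt g (d x) (Ioc 0 1) x)
    (h1 : f 1 = g 1) : EqOn f g (Ioc 0 1) := by
  intro r hr
  have h := (convex_Ioc (0:ℝ) 1).norm_image_sub_le_of_norm_hasDerivWithin_le
    (C := 0) (fun x hx => (hf x hx).sub (hg x hx)) (by simp)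
    hr (right_mem_Ioc.2 one_pos)
  have h' := norm_le_zero_iff.1 (h.trans_eq (zero_mul _))
  simp only [Pi.sub_apply] at h'
  linarith

/-- Two functions on `(0, 1]` with the same second derivative, and the same value and derivative
at `1`, agree. -/
lemma eqOn_Ioc_of_hasDerivWithinAt_two {f f' g g' d : ℝ → ℝ}
    (hf : ∀ x ∈ Ioc (0:ℝ) 1, HasDerivWithinAt f (f' x) (Ioc 0 1) x)
    (hf' : ∀ x ∈ Ioc (0:ℝ) 1, HasDerivWithinAt f' (d x) (Ioc 0 1) x)
    (hg : ∀ x ∈ Ioc (0:ℝ) 1, HasDerivAt g (g' x) x)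
    (hg' : ∀ x ∈ Ioc (0:ℝ) 1, HasDerivAt g' (d x) x)
    (h1 : f 1 = g 1) (h1' : f' 1 = g' 1) : EqOn f g (Ioc 0 1) := by
  have h := eqOn_Ioc_of_hasDerivWithinAt hf' (fun x hx => (hg' x hx).hasDerivWithinAt) h1'
  refine eqOn_Ioc_of_hasDerivWithinAt hf (fun x hx => ?_) h1
  rw [h hx]
  exact (hg x hx).hasDerivWithinAt

/-- A function which is continuous at `0` from the right is not, up to affine terms, a nonzero
multiple of a function that blows up at `0`. -/
lemma not_eqOn_Ioc_of_tendsto_atTop {s L : ℝ → ℝ} {c a b : ℝ}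
    (hs : ContinuousOn s (Icc 0 1)) (hL : Tendsto L (𝓝[>] 0) atTop) (hc : c ≠ 0) :
    ¬ EqOn s (fun r => c * L r + a * r + b) (Ioc 0 1) := by
  intro h
  have hIoc : Ioc (0:ℝ) 1 ∈ 𝓝[>] (0:ℝ) := Ioc_mem_nhdsGT one_pos
  have hs0 : Tendsto s (𝓝[>] 0) (𝓝 (s 0)) :=
    (hs 0 (left_mem_Icc.2 zero_le_one)).mono_left
      (nhdsWithin_le_iff.2 (mem_of_superset hIoc Ioc_subset_Icc_self))
  have hid : Tendsto (fun r : ℝ => r) (𝓝[>] 0) (𝓝 0) := tendsto_nhdsWithin_of_tendsto_nhds tendsto_id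
  have hlim := ((hs0.sub (hid.const_mul a)).sub_const b).div_const c
  refine not_tendsto_nhds_of_tendsto_atTop hL _ (hlim.congr' ?_)
  filter_upwards [hIoc] with r hr
  rw [h hr]
  field_simp
  ring

/-- Integrating `s''(r) = s''(1) r^{q−2}` twice: the density `s` must be (up to affine
terms) the Boltzmann–Gibbs density if `q = 1`, the case `q = 0` is impossible, and
otherwise `q > 0` and `s` is the Tsallis density. Here `r ^ q` denotes the real power. -/
theorem stmt_10
    (q : ℝ) (s s' s'' : ℝ → ℝ)
    (hs : ContinuousOn s (Icc 0 1))
    (hds : ∀ x ∈ Ioc (0:ℝ) 1, HasDerivWithinAt s (s' x) (Ioc 0 1) x)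
    (hds' : ∀ x ∈ Ioc (0:ℝ) 1, HasDerivWithinAt s' (s'' x) (Ioc 0 1) x)
    (hs''cont : ContinuousOn s'' (Ioc 0 1))
    (hneg1 : s'' 1 < 0)
    (hpow : ∀ r ∈ Ioc (0:ℝ) 1, s'' r = s'' 1 * r ^ (q - 2)) :
    -- (a) the case q = 1
    (q = 1 → ∀ r ∈ Ioc (0:ℝ) 1,
      s r = s'' 1 * (r * Real.log r) + (-s'' 1 + s' 1) * r + (s'' 1 - s' 1 + s 1)) ∧
    -- (b) the case q = 0 is impossible
    q ≠ 0 ∧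
    -- (c) the case q ≠ 0, q ≠ 1
    (q ≠ 0 → q ≠ 1 → 0 < q ∧ ∀ r ∈ Ioc (0:ℝ) 1,
      s r = (s'' 1 / q) * ((r ^ q - r) / (q - 1)) + (-(s'' 1 / q) + s' 1) * r +
        (s'' 1 / q - s' 1 + s 1)) := by
  have hds2 : ∀ x ∈ Ioc (0:ℝ) 1, HasDerivWithinAt s' (s'' 1 * x ^ (q - 2)) (Ioc 0 1) x :=
    fun x hx => hpow x hx ▸ hds' x hx
  refine ⟨?_, ?_, ?_⟩
  · rintro rfl
    refine eqOn_Ioc_of_hasDerivWithinAt_two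
      (g' := fun r => s'' 1 * (Real.log r + 1) + (-s'' 1 + s' 1)) hds hds2 ?_ ?_ ?_ ?_
    · intro x hx
      simpa using (((Real.hasDerivAt_mul_log hx.1.ne').const_mul (s'' 1)).add
        ((hasDerivAt_id' x).const_mul (-s'' 1 + s' 1))).add_const (s'' 1 - s' 1 + s 1)
    · intro x hx
      have h := (((Real.hasDerivAt_log hx.1.ne').add_const 1).const_mul (s'' 1)).add_const
        (-s'' 1 + s' 1)
      rwa [← Real.rpow_neg_one, show (-1:ℝ) = 1 - 2 by norm_num] at h
    · simp only [Real.log_one]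
      ring
    · simp
  · rintro rfl
    refine not_eqOn_Ioc_of_tendsto_atTop (L := fun r => -Real.log r) (c := s'' 1)
      (a := s'' 1 + s' 1) (b := s 1 - s'' 1 - s' 1) hs
      (tendsto_neg_atBot_atTop.comp Real.tendsto_log_nhdsGT_zero) hneg1.ne ?_
    refine eqOn_Ioc_of_hasDerivWithinAt_two
      (g' := fun r => s'' 1 * (-r⁻¹) + (s'' 1 + s' 1)) hds hds2 ?_ ?_ ?_ ?_
    · intro x hx
      simpa using (((Real.hasDerivAt_log hx.1.ne').neg.const_mul (s'' 1)).add
        ((hasDerivAt_id' x).const_mul (s'' 1 + s' 1))).add_const (s 1 - s'' 1 - s' 1)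
    · intro x hx
      refine (((hasDerivAt_inv hx.1.ne').neg.const_mul (s'' 1)).add_const
        (s'' 1 + s' 1)).congr_deriv ?_
      rw [zero_sub, Real.rpow_neg hx.1.le, Real.rpow_two, neg_neg]
    · simp
    · simp
  · intro hq0 hq1
    have hq1' : q - 1 ≠ 0 := sub_ne_zero.2 hq1
    have key : EqOn s (fun r => (s'' 1 / q) * ((r ^ q - r) / (q - 1)) +
        (-(s'' 1 / q) + s' 1) * r + (s'' 1 / q - s' 1 + s 1)) (Ioc 0 1) := by
      refine eqOn_Ioc_of_hasDerivWithinAt_two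
        (g' := fun r => (s'' 1 / q) * ((q * r ^ (q - 1) - 1) / (q - 1)) + (-(s'' 1 / q) + s' 1))
        hds hds2 ?_ ?_ ?_ ?_
      · intro x hx
        simpa using (((((Real.hasDerivAt_rpow_const (p := q) (Or.inl hx.1.ne')).sub
          (hasDerivAt_id' x)).div_const (q - 1)).const_mul (s'' 1 / q)).add
          ((hasDerivAt_id' x).const_mul (-(s'' 1 / q) + s' 1))).add_const (s'' 1 / q - s' 1 + s 1)
      · intro x hx
        refine ((((((Real.hasDerivAt_rpow_const (p := q - 1) (Or.inl hx.1.ne')).const_mul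
          q).sub_const 1).div_const (q - 1)).const_mul (s'' 1 / q)).add_const
          (-(s'' 1 / q) + s' 1)).congr_deriv ?_
        rw [show q - 1 - 1 = q - 2 by ring]
        field_simp
      · simp only [Real.one_rpow]
        ring
      · simp [hq1']
    refine ⟨?_, key⟩
    by_contra hq
    have hqneg : q < 0 := lt_of_le_of_ne (not_lt.1 hq) hq0
    refine not_eqOn_Ioc_of_tendsto_atTop (L := fun r => r ^ q) (c := s'' 1 / q / (q - 1))
      (a := -(s'' 1 / q) + s' 1 - s'' 1 / q / (q - 1)) (b := s'' 1 / q - s' 1 + s 1) hs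
      (tendsto_rpow_neg_nhdsGT_zero hqneg)
      (div_ne_zero (div_ne_zero hneg1.ne hq0) hq1') (fun r hr => ?_)
    rw [key hr]
    ring
end

section
/- Let s ∈ C([0,1]) ∩ C²((0,1]) with s(0) = s(1) = 0 and s'' < 0 on (0,1], and assume sup_{t∈(0,1]} s''(rt)/s''(t) < ∞ for every r ∈ (0,1]. Define f̲(r) = r² inf_{t∈(0,1]} s''(rt)/s''(t) and f̄(r) = r² sup_{t∈(0,1]} s''(rt)/s''(t). Then for all p ∈ (0,1] and r ∈ (0,1]: f̲(p)·(s'(1) r − s(r)) ≥ p s'(p) r − s(pr) ≥ f̄(p)·(s'(1) r − s(r)). In particular (taking r = 1), f̲(p) s'(1) ≥ p s'(p) − s(p) ≥ f̄(p) s'(1). -/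
open Real Set

/-- If `f'' ≤ g''` on `(0,1]`, `f'(1) = g'(1)` and `f(0) = g(0)`, then `g ≤ f` on `(0,1]`. -/
theorem le_of_second_deriv_le {f f' f'' g g' g'' : ℝ → ℝ}
    (hf : ContinuousOn f (Icc 0 1)) (hg : ContinuousOn g (Icc 0 1))
    (hf' : ∀ x ∈ Ioc (0:ℝ) 1, HasDerivWithinAt f (f' x) (Ioc 0 1) x)
    (hg' : ∀ x ∈ Ioc (0:ℝ) 1, HasDerivWithinAt g (g' x) (Ioc 0 1) x)
    (hf'' : ∀ x ∈ Ioc (0:ℝ) 1, HasDerivWithinAt f' (f'' x) (Ioc 0 1) x)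
    (hg'' : ∀ x ∈ Ioc (0:ℝ) 1, HasDerivWithinAt g' (g'' x) (Ioc 0 1) x)
    (hle : ∀ x ∈ Ioc (0:ℝ) 1, f'' x ≤ g'' x)
    (h1 : f' 1 = g' 1) (h0 : f 0 = g 0) {r : ℝ} (hr : r ∈ Ioc (0:ℝ) 1) :
    g r ≤ f r := by
  have hanti : AntitoneOn (f' - g') (Ioc 0 1) := by
    refine antitoneOn_of_hasDerivWithinAt_nonpos (f' := f'' - g'') (convex_Ioc 0 1)
      (fun x hx => ((hf'' x hx).sub (hg'' x hx)).continuousWithinAt) (fun x hx => ?_)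
      (fun x hx => sub_nonpos.2 (hle x (interior_subset hx)))
    have hx' := interior_subset hx
    exact ((hf'' x hx').sub (hg'' x hx')).mono interior_subset
  have hsub : interior (Icc (0:ℝ) 1) ⊆ Ioc 0 1 := by
    rw [interior_Icc]
    exact Ioo_subset_Ioc_self
  have hmono : MonotoneOn (f - g) (Icc 0 1) := by
    refine monotoneOn_of_hasDerivWithinAt_nonneg (f' := f' - g') (convex_Icc 0 1)
      (hf.sub hg) (fun x hx => ?_) (fun x hx => ?_)
    · exact ((hf' x (hsub hx)).sub (hg' x (hsub hx))).mono hsub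
    · have := hanti (hsub hx) (right_mem_Ioc.2 one_pos) (hsub hx).2
      simpa [h1] using this
  have := hmono (left_mem_Icc.2 zero_le_one) (Ioc_subset_Icc_self hr) hr.1.le
  simpa [h0] using this

/-- Pointwise two-sided bound obtained by integrating the second-derivative bounds
twice: `f̲(p)(s'(1) r − s(r)) ≥ p s'(p) r − s(pr) ≥ f̄(p)(s'(1) r − s(r))`, and in
particular (r = 1) `f̲(p) s'(1) ≥ p s'(p) − s(p) ≥ f̄(p) s'(1)`. -/
theorem stmt_12
    (s s' s'' : ℝ → ℝ)
    (hs : ContinuousOn s (Icc 0 1))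
    (hs0 : s 0 = 0) (hs1 : s 1 = 0)
    (hds : ∀ x ∈ Ioc (0:ℝ) 1, HasDerivWithinAt s (s' x) (Ioc 0 1) x)
    (hds' : ∀ x ∈ Ioc (0:ℝ) 1, HasDerivWithinAt s' (s'' x) (Ioc 0 1) x)
    (hs''cont : ContinuousOn s'' (Ioc 0 1))
    (hneg : ∀ x ∈ Ioc (0:ℝ) 1, s'' x < 0)
    (hbdd : ∀ r ∈ Ioc (0:ℝ) 1,
      BddAbove (Set.range fun t : Set.Ioc (0:ℝ) 1 => s'' (r * (t : ℝ)) / s'' (t : ℝ)))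
    (p r : ℝ) (hp : p ∈ Ioc (0:ℝ) 1) (hr : r ∈ Ioc (0:ℝ) 1) :
    (fup s'' p * (s' 1 * r - s r) ≤ p * s' p * r - s (p * r) ∧
      p * s' p * r - s (p * r) ≤ flo s'' p * (s' 1 * r - s r)) ∧
    (fup s'' p * s' 1 ≤ p * s' p - s p ∧ p * s' p - s p ≤ flo s'' p * s' 1) := by
  have hmaps : MapsTo (fun t => p * t) (Ioc (0:ℝ) 1) (Ioc 0 1) := fun t ht =>
    ⟨mul_pos hp.1 ht.1, mul_le_one₀ hp.2 ht.1.le ht.2⟩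
  have hmaps' : MapsTo (fun t => p * t) (Icc (0:ℝ) 1) (Icc 0 1) := fun t ht =>
    ⟨mul_nonneg hp.1.le ht.1, mul_le_one₀ hp.2 ht.1 ht.2⟩
  have hid (a x : ℝ) : HasDerivWithinAt (fun t => a * t) a (Ioc 0 1) x := by
    simpa using (hasDerivWithinAt_id x (Ioc 0 1)).const_mul a
  have hgc : ContinuousOn (fun t => p * s' p * t - s (p * t)) (Icc 0 1) :=
    (continuous_const_mul _).continuousOn.sub
      (hs.comp (continuous_const_mul p).continuousOn hmaps')
  have hg1 : ∀ x ∈ Ioc (0:ℝ) 1, HasDerivWithinAt (fun t => p * s' p * t - s (p * t))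
      (p * s' p - s' (p * x) * p) (Ioc 0 1) x := fun x hx =>
    (hid _ x).sub ((hds _ (hmaps hx)).comp x (hid p x) hmaps)
  have hg2 : ∀ x ∈ Ioc (0:ℝ) 1, HasDerivWithinAt (fun t => p * s' p - s' (p * t) * p)
      (-(s'' (p * x) * p * p)) (Ioc 0 1) x := fun x hx =>
    (((hds' _ (hmaps hx)).comp x (hid p x) hmaps).mul_const p).const_sub _
  have hhc (c : ℝ) : ContinuousOn (fun t => c * (s' 1 * t - s t)) (Icc 0 1) :=
    ((continuous_const_mul _).continuousOn.sub hs).const_mul c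
  have hh1 (c : ℝ) : ∀ x ∈ Ioc (0:ℝ) 1, HasDerivWithinAt (fun t => c * (s' 1 * t - s t))
      (c * (s' 1 - s' x)) (Ioc 0 1) x := fun x hx =>
    ((hid _ x).sub (hds x hx)).const_mul c
  have hh2 (c : ℝ) : ∀ x ∈ Ioc (0:ℝ) 1, HasDerivWithinAt (fun t => c * (s' 1 - s' t))
      (c * -s'' x) (Ioc 0 1) x := fun x hx =>
    ((hds' x hx).const_sub _).const_mul c
  have hup : ∀ x ∈ Ioc (0:ℝ) 1, -(s'' (p * x) * p * p) ≤ fup s'' p * -s'' x := by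
    intro x hx
    have h := le_ciSup (hbdd p hp) ⟨x, hx⟩
    rw [div_le_iff_of_neg (hneg x hx)] at h
    have := mul_le_mul_of_nonneg_left h (sq_nonneg p)
    unfold fup
    linarith
  have hbelow : BddBelow
      (Set.range fun t : Set.Ioc (0:ℝ) 1 => s'' (p * (t : ℝ)) / s'' (t : ℝ)) := by
    refine ⟨0, ?_⟩
    rintro _ ⟨t, rfl⟩
    exact (div_pos_of_neg_of_neg (hneg _ (hmaps t.2)) (hneg _ t.2)).le
  have hlo : ∀ x ∈ Ioc (0:ℝ) 1, flo s'' p * -s'' x ≤ -(s'' (p * x) * p * p) := by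
    intro x hx
    have h := ciInf_le hbelow ⟨x, hx⟩
    rw [le_div_iff_of_neg (hneg x hx)] at h
    have := mul_le_mul_of_nonneg_left h (sq_nonneg p)
    unfold flo
    linarith
  have key : ∀ x ∈ Ioc (0:ℝ) 1,
      fup s'' p * (s' 1 * x - s x) ≤ p * s' p * x - s (p * x) ∧
        p * s' p * x - s (p * x) ≤ flo s'' p * (s' 1 * x - s x) := fun x hx =>
    ⟨le_of_second_deriv_le hgc (hhc _) hg1 (hh1 _) hg2 (hh2 _) hup
        (by ring_nf) (by simp [hs0]) hx,
      le_of_second_deriv_le (hhc _) hgc (hh1 _) hg1 (hh2 _) hg2 hlo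
        (by ring_nf) (by simp [hs0]) hx⟩
  refine ⟨key r hr, ?_⟩
  simpa [hs1] using key 1 (right_mem_Ioc.2 one_pos)
end

section
/- Define s : [0,1] → ℝ by s(r) = −∫_0^r log sin(πt/4) dt + C r, where C = ∫_0^1 log sin(πt/4) dt. Then s ∈ C([0,1]) ∩ C²((0,1]), s(0) = s(1) = 0, s''(r) = −(π/4)cot(πr/4) < 0 on (0,1], s'(1) < 0, and for all u ∈ (0,1]: 2 = inf_{t∈(0,1]} s''(t/2)/s''(t) ≤ s''(u/2)/s''(u) = (cos(πu/4) + 1)/cos(πu/4) ≤ sup_{t∈(0,1]} s''(t/2)/s''(t) = 1 + √2. -/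
open Real Set

/-- `C = ∫_0^1 log sin(πt/4) dt`. -/
noncomputable def logSinConst : ℝ := ∫ t in (0:ℝ)..1, Real.log (Real.sin (Real.pi / 4 * t))

/-- `s(r) = −∫_0^r log sin(πt/4) dt + C r`. -/
noncomputable def cotDensity (r : ℝ) : ℝ :=
  -(∫ t in (0:ℝ)..r, Real.log (Real.sin (Real.pi / 4 * t))) + logSinConst * r

section

open Filter Topology MeasureTheory

lemma intervalIntegrable_log_sin_pi_div_four_mul (a b : ℝ) :
    IntervalIntegrable (fun t => Real.log (Real.sin (π / 4 * t))) volume a b := by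
  have h := (intervalIntegrable_log_sin (a := π / 4 * a) (b := π / 4 * b)).comp_mul_left
    (c := π / 4)
  have hpi : π / 4 ≠ 0 := by positivity
  simpa [mul_div_cancel_left₀ _ hpi] using h

lemma sin_pi_div_four_mul_pos {r : ℝ} (hr : r ∈ Ioo (0 : ℝ) 4) :
    0 < Real.sin (π / 4 * r) := by
  have := Real.pi_pos
  apply Real.sin_pos_of_pos_of_lt_pi
  · exact mul_pos (by positivity) hr.1
  · nlinarith [hr.2]

lemma cos_pi_div_four_mul_pos {r : ℝ} (hr : r ∈ Ioo (0 : ℝ) 2) :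
    0 < Real.cos (π / 4 * r) := by
  have := Real.pi_pos
  apply Real.cos_pos_of_mem_Ioo
  constructor <;> nlinarith [hr.1, hr.2]

lemma continuous_cotDensity : Continuous cotDensity := by
  unfold cotDensity
  have h := intervalIntegral.continuous_primitive
    (fun a b => intervalIntegrable_log_sin_pi_div_four_mul a b) 0
  exact h.neg.add (by fun_prop)

lemma cotDensity_zero : cotDensity 0 = 0 := by simp [cotDensity]

lemma cotDensity_one : cotDensity 1 = 0 := by simp [cotDensity, logSinConst]

lemma hasDerivAt_cotDensity {r : ℝ} (hr : r ∈ Ioo (0 : ℝ) 4) :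
    HasDerivAt cotDensity (-Real.log (Real.sin (π / 4 * r)) + logSinConst) r := by
  have hcont : ContinuousAt (fun t => Real.log (Real.sin (π / 4 * t))) r :=
    ContinuousAt.log (by fun_prop) (sin_pi_div_four_mul_pos hr).ne'
  have hmeas : Measurable (fun t => Real.log (Real.sin (π / 4 * t))) := by fun_prop
  have h := intervalIntegral.integral_hasDerivAt_right
    (intervalIntegrable_log_sin_pi_div_four_mul 0 r)
    hmeas.stronglyMeasurable.stronglyMeasurableAtFilter hcont
  exact (h.neg.add ((hasDerivAt_id r).const_mul logSinConst)).congr_deriv (by simp)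

lemma hasDerivAt_deriv_cotDensity {r : ℝ} (hr : r ∈ Ioo (0 : ℝ) 4) :
    HasDerivAt (deriv cotDensity)
      (-(π / 4) * (Real.cos (π / 4 * r) / Real.sin (π / 4 * r))) r := by
  have heq : deriv cotDensity =ᶠ[𝓝 r]
      fun t => -Real.log (Real.sin (π / 4 * t)) + logSinConst := by
    filter_upwards [isOpen_Ioo.mem_nhds hr] with t ht using (hasDerivAt_cotDensity ht).deriv
  have h := (((((hasDerivAt_id r).const_mul (π / 4)).sin).log
    (sin_pi_div_four_mul_pos hr).ne').neg).add_const logSinConst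
  refine (h.congr_of_eventuallyEq heq).congr_deriv ?_
  simp only [id, mul_one]
  ring

lemma deriv_deriv_cotDensity {r : ℝ} (hr : r ∈ Ioo (0 : ℝ) 4) :
    deriv (deriv cotDensity) r =
      -(π / 4) * (Real.cos (π / 4 * r) / Real.sin (π / 4 * r)) :=
  (hasDerivAt_deriv_cotDensity hr).deriv

lemma deriv_deriv_cotDensity_neg {r : ℝ} (hr : r ∈ Ioo (0 : ℝ) 2) :
    deriv (deriv cotDensity) r < 0 := by
  have hr' : r ∈ Ioo (0 : ℝ) 4 := ⟨hr.1, by linarith [hr.2]⟩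
  rw [deriv_deriv_cotDensity hr']
  have hcot := div_pos (cos_pi_div_four_mul_pos hr) (sin_pi_div_four_mul_pos hr')
  exact mul_neg_of_neg_of_pos (by linarith [Real.pi_pos]) hcot

lemma deriv_cotDensity_one_neg : deriv cotDensity 1 < 0 := by
  obtain ⟨c, hc, hc0⟩ := exists_deriv_eq_zero zero_lt_one continuous_cotDensity.continuousOn
    (cotDensity_zero.trans cotDensity_one.symm)
  have hanti : StrictAntiOn (deriv cotDensity) (Icc c 1) := by
    refine strictAntiOn_of_deriv_neg (convex_Icc c 1) (fun x hx => ?_) (fun x hx => ?_)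
    · exact (hasDerivAt_deriv_cotDensity
        ⟨hc.1.trans_le hx.1, by linarith [hx.2]⟩).continuousAt.continuousWithinAt
    · rw [interior_Icc] at hx
      exact deriv_deriv_cotDensity_neg ⟨hc.1.trans hx.1, by linarith [hx.2]⟩
  rw [← hc0]
  exact hanti (left_mem_Icc.2 hc.2.le) (right_mem_Icc.2 hc.2.le) hc.2

lemma deriv_deriv_cotDensity_half_div {u : ℝ} (hu : u ∈ Ioo (0 : ℝ) 2) :
    deriv (deriv cotDensity) (u / 2) / deriv (deriv cotDensity) u =
      (Real.cos (π * u / 4) + 1) / Real.cos (π * u / 4) := by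
  have hu2 : u / 2 ∈ Ioo (0 : ℝ) 2 := ⟨by linarith [hu.1], by linarith [hu.1, hu.2]⟩
  have hu4 : u / 2 ∈ Ioo (0 : ℝ) 4 := ⟨hu2.1, by linarith [hu2.2]⟩
  rw [deriv_deriv_cotDensity hu4, deriv_deriv_cotDensity ⟨hu.1, by linarith [hu.2]⟩]
  have hs := sin_pi_div_four_mul_pos hu4
  have hc := cos_pi_div_four_mul_pos hu2
  have hcu := cos_pi_div_four_mul_pos hu
  have hdouble : π / 4 * u = 2 * (π / 4 * (u / 2)) := by ring
  rw [show π * u / 4 = π / 4 * u by ring]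
  rw [hdouble] at hcu ⊢
  have hpi := Real.pi_ne_zero
  have hcos := Real.cos_two_mul (π / 4 * (u / 2))
  rw [Real.sin_two_mul]
  generalize Real.cos (2 * (π / 4 * (u / 2))) = d at *
  generalize Real.cos (π / 4 * (u / 2)) = c at *
  generalize Real.sin (π / 4 * (u / 2)) = s at *
  have hs' := hs.ne'
  have hc' := hc.ne'
  have hcu' := hcu.ne'
  field_simp
  linarith

lemma two_le_deriv_deriv_cotDensity_half_div {u : ℝ} (hu : u ∈ Ioo (0 : ℝ) 2) :
    2 ≤ deriv (deriv cotDensity) (u / 2) / deriv (deriv cotDensity) u := by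
  have hc := cos_pi_div_four_mul_pos hu
  rw [deriv_deriv_cotDensity_half_div hu, show π * u / 4 = π / 4 * u by ring, le_div_iff₀ hc]
  linarith [Real.cos_le_one (π / 4 * u)]

lemma deriv_deriv_cotDensity_half_div_one :
    deriv (deriv cotDensity) (1 / 2) / deriv (deriv cotDensity) 1 = 1 + √2 := by
  rw [deriv_deriv_cotDensity_half_div ⟨one_pos, one_lt_two⟩, mul_one, Real.cos_pi_div_four]
  have h2 : √2 * √2 = 2 := Real.mul_self_sqrt zero_le_two
  have hpos : 0 < √2 := by positivity
  rw [div_eq_iff (by positivity)]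
  nlinarith

lemma deriv_deriv_cotDensity_half_div_le {u : ℝ} (hu : u ∈ Ioc (0 : ℝ) 1) :
    deriv (deriv cotDensity) (u / 2) / deriv (deriv cotDensity) u ≤ 1 + √2 := by
  have hu2 : u ∈ Ioo (0 : ℝ) 2 := ⟨hu.1, by linarith [hu.2]⟩
  have h1 : (1 : ℝ) ∈ Ioo (0 : ℝ) 2 := ⟨one_pos, one_lt_two⟩
  have hc := cos_pi_div_four_mul_pos hu2
  have hc1 := cos_pi_div_four_mul_pos h1
  have hle : Real.cos (π / 4 * 1) ≤ Real.cos (π / 4 * u) := by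
    have := Real.pi_pos
    apply Real.cos_le_cos_of_nonneg_of_le_pi <;> nlinarith [hu.1, hu.2]
  rw [← deriv_deriv_cotDensity_half_div_one, deriv_deriv_cotDensity_half_div hu2,
    deriv_deriv_cotDensity_half_div h1, show π * u / 4 = π / 4 * u by ring,
    show π * 1 / 4 = π / 4 * 1 by ring, div_le_div_iff₀ hc hc1]
  nlinarith

lemma iInf_deriv_deriv_cotDensity_half_div :
    (⨅ t : Ioc (0 : ℝ) 1,
      deriv (deriv cotDensity) ((t : ℝ) / 2) / deriv (deriv cotDensity) (t : ℝ)) = 2 := by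
  have : Nonempty (Ioc (0 : ℝ) 1) := ⟨⟨1, one_pos, le_rfl⟩⟩
  refine ciInf_eq_of_forall_ge_of_forall_gt_exists_lt (fun t =>
    two_le_deriv_deriv_cotDensity_half_div ⟨t.2.1, by linarith [t.2.2]⟩) fun w hw => ?_
  have hcont : ContinuousAt
      (fun t : ℝ => (Real.cos (π * t / 4) + 1) / Real.cos (π * t / 4)) 0 :=
    ContinuousAt.div (by fun_prop) (by fun_prop) (by simp)
  have hlt : ∀ᶠ t in 𝓝[>] (0 : ℝ),
      (Real.cos (π * t / 4) + 1) / Real.cos (π * t / 4) < w := by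
    refine (hcont.eventually_lt_const ?_).filter_mono nhdsWithin_le_nhds
    norm_num
    exact hw
  obtain ⟨t, htw, ht⟩ := (hlt.and (Ioc_mem_nhdsGT (zero_lt_one' ℝ))).exists
  refine ⟨⟨t, ht⟩, ?_⟩
  rwa [deriv_deriv_cotDensity_half_div ⟨ht.1, by linarith [ht.2]⟩]

lemma iSup_deriv_deriv_cotDensity_half_div :
    (⨆ t : Ioc (0 : ℝ) 1,
      deriv (deriv cotDensity) ((t : ℝ) / 2) / deriv (deriv cotDensity) (t : ℝ)) =
        1 + √2 := by
  have : Nonempty (Ioc (0 : ℝ) 1) := ⟨⟨1, one_pos, le_rfl⟩⟩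
  refine ciSup_eq_of_forall_le_of_forall_lt_exists_gt
    (fun t => deriv_deriv_cotDensity_half_div_le t.2) fun w hw => ?_
  exact ⟨⟨1, one_pos, le_rfl⟩, hw.trans_eq deriv_deriv_cotDensity_half_div_one.symm⟩

end

/-- The function `s(r) = −∫_0^r log sin(πt/4) dt + C r` is continuous on `[0,1]` with
`s(0) = s(1) = 0`, `C²` on `(0,1]` with `s''(r) = −(π/4)cot(πr/4) < 0` and `s'(1) < 0`,
and `inf_{t∈(0,1]} s''(t/2)/s''(t) = 2`, `sup_{t∈(0,1]} s''(t/2)/s''(t) = 1 + √2`, the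
ratio being `(cos(πu/4) + 1)/cos(πu/4)`. -/
theorem stmt_13 :
    ContinuousOn cotDensity (Icc 0 1) ∧
    cotDensity 0 = 0 ∧ cotDensity 1 = 0 ∧
    (∀ r ∈ Ioc (0:ℝ) 1,
      DifferentiableAt ℝ cotDensity r ∧
      DifferentiableAt ℝ (deriv cotDensity) r ∧
      deriv (deriv cotDensity) r =
        -(Real.pi / 4) * (Real.cos (Real.pi / 4 * r) / Real.sin (Real.pi / 4 * r)) ∧
      deriv (deriv cotDensity) r < 0) ∧
    deriv cotDensity 1 < 0 ∧
    (⨅ t : Ioc (0:ℝ) 1,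
      deriv (deriv cotDensity) ((t : ℝ) / 2) / deriv (deriv cotDensity) (t : ℝ)) = 2 ∧
    (⨆ t : Ioc (0:ℝ) 1,
      deriv (deriv cotDensity) ((t : ℝ) / 2) / deriv (deriv cotDensity) (t : ℝ)) =
        1 + Real.sqrt 2 ∧
    (∀ u ∈ Ioc (0:ℝ) 1,
      deriv (deriv cotDensity) (u / 2) / deriv (deriv cotDensity) u =
        (Real.cos (Real.pi * u / 4) + 1) / Real.cos (Real.pi * u / 4) ∧
      2 ≤ deriv (deriv cotDensity) (u / 2) / deriv (deriv cotDensity) u ∧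
      deriv (deriv cotDensity) (u / 2) / deriv (deriv cotDensity) u ≤ 1 + Real.sqrt 2) := by
  have hsub {r : ℝ} (hr : r ∈ Ioc (0 : ℝ) 1) : r ∈ Ioo (0 : ℝ) 2 :=
    ⟨hr.1, by linarith [hr.2]⟩
  refine ⟨continuous_cotDensity.continuousOn, cotDensity_zero, cotDensity_one, fun r hr => ?_,
    deriv_cotDensity_one_neg, iInf_deriv_deriv_cotDensity_half_div,
    iSup_deriv_deriv_cotDensity_half_div, fun u hu => ?_⟩
  · have hr4 : r ∈ Ioo (0 : ℝ) 4 := ⟨hr.1, by linarith [hr.2]⟩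
    exact ⟨(hasDerivAt_cotDensity hr4).differentiableAt,
      (hasDerivAt_deriv_cotDensity hr4).differentiableAt, deriv_deriv_cotDensity hr4,
      deriv_deriv_cotDensity_neg (hsub hr)⟩
  · exact ⟨deriv_deriv_cotDensity_half_div (hsub hu),
      two_le_deriv_deriv_cotDensity_half_div (hsub hu), deriv_deriv_cotDensity_half_div_le hu⟩
end
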